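/- Let f be an area-preserving homeomorphism of the closed annulus 𝔸 = (ℝ/ℤ)×[-1,1] admitting a lift f̃, and assume f is NICIS. Then the rotation set of f̃ is a single irrational number: there exists an irrational α ∈ ℝ such that for every f-invariant Borel probability measure μ on 𝔸 one has ∫_𝔸 (p∘f̃ − p) dμ = α. -/

import Mathlib

open MeasureTheory Set

attribute [local instance] MeasureTheory.Measure.Subtype.measureSpace

noncomputable section

/-- The closed annulus `𝔸 = (ℝ/ℤ) × [-1,1]`. -/
abbrev Annulus := AddCircle (1 : ℝ) × (Set.Icc (-1 : ℝ) 1)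

/-- The universal cover `ℝ × [-1,1]` of the closed annulus. -/
abbrev AnnulusCover := ℝ × (Set.Icc (-1 : ℝ) 1)

/-- The covering projection `ℝ × [-1,1] → (ℝ/ℤ) × [-1,1]`. -/
def annulusProj (z : AnnulusCover) : Annulus := ((z.1 : AddCircle (1 : ℝ)), z.2)

/-- The interior `(ℝ/ℤ) × (-1,1)` of the closed annulus. -/
def annulusInt : Set Annulus := {z | -1 < (z.2 : ℝ) ∧ (z.2 : ℝ) < 1}

/-- The upper boundary circle `(ℝ/ℤ) × {1}`. -/
def annulusBdryPlus : Set Annulus := {z | (z.2 : ℝ) = 1}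

/-- `ft` is a lift of the homeomorphism `f` of the annulus: it commutes with the deck
transformation `(x,y) ↦ (x+1,y)` and descends to `f`. -/
def IsLift (f : Annulus ≃ₜ Annulus) (ft : AnnulusCover ≃ₜ AnnulusCover) : Prop :=
  (∀ z : AnnulusCover, ft (z.1 + 1, z.2) = ((ft z).1 + 1, (ft z).2)) ∧
  (∀ z : AnnulusCover, f (annulusProj z) = annulusProj (ft z))

/-- `f` admits no nonempty compact invariant set contained in the interior of the annulus. -/
def NICIS (f : Annulus ≃ₜ Annulus) : Prop :=
  ¬ ∃ K : Set Annulus, K.Nonempty ∧ IsCompact K ∧ f '' K = K ∧ K ⊆ annulusInt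

/-- A nonvanishing continuous function on a star-convex set has a continuous logarithm. -/
theorem exists_continuousOn_log {E : Type*} [AddCommGroup E] [Module ℝ E] [TopologicalSpace E]
    [IsTopologicalAddGroup E] [ContinuousSMul ℝ E] {Z : Set E} {x₀ : E} (hZ : StarConvex ℝ x₀ Z)
    (hx₀ : x₀ ∈ Z) {g : E → ℂ} (hg : ContinuousOn g Z) (h0 : ∀ x ∈ Z, g x ≠ 0) :
    ∃ l : E → ℂ, ContinuousOn l Z ∧ ∀ x ∈ Z, Complex.exp (l x) = g x := by
  classical
  have hseg : ∀ (t : unitInterval) (x : Z), x₀ + (t : ℝ) • ((x : E) - x₀) ∈ Z := fun t x ↦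
    hZ.add_smul_sub_mem x.2 t.2.1 t.2.2
  let H : C(unitInterval × Z, {z : ℂ // z ≠ 0}) :=
    ⟨fun p ↦ ⟨g (x₀ + (p.1 : ℝ) • ((p.2 : E) - x₀)), h0 _ (hseg p.1 p.2)⟩, by
      refine Continuous.subtype_mk ?_ _
      exact hg.comp_continuous (by fun_prop) fun p ↦ hseg p.1 p.2⟩
  let c₀ : C(Z, ℂ) := ContinuousMap.const _ (Complex.log (g x₀))
  have H0 : ∀ a, H (0, a) = (⟨_, (c₀ a).exp_ne_zero⟩ : {z : ℂ // z ≠ 0}) := by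
    intro a
    apply Subtype.ext
    simp [H, c₀, Complex.exp_log (h0 _ hx₀)]
  let L := Complex.isCoveringMap_exp.liftHomotopy H c₀ H0
  have hL := Complex.isCoveringMap_exp.liftHomotopy_lifts H c₀ H0
  refine ⟨fun x ↦ if hx : x ∈ Z then L (1, ⟨x, hx⟩) else 0, ?_, ?_⟩
  · rw [continuousOn_iff_continuous_domRestrict]
    have : Z.domRestrict (fun x ↦ if hx : x ∈ Z then L (1, ⟨x, hx⟩) else 0) = fun x ↦ L (1, x) := by
      ext x; simp [Set.domRestrict]
    rw [this]; fun_prop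
  · intro x hx
    have := congrArg Subtype.val (congrFun hL (1, ⟨x, hx⟩))
    simp only [dif_pos hx]
    exact this.trans (by simp [H])

/-- A continuous function on a preconnected set whose exponential is constant is constant. -/
theorem eq_of_exp_eq_of_isPreconnected {X : Type*} [TopologicalSpace X] {Z : Set X}
    (hZ : IsPreconnected Z) {d : X → ℂ} (hd : ContinuousOn d Z) {c : ℂ}
    (h : ∀ x ∈ Z, Complex.exp (d x) = c) {x y : X} (hx : x ∈ Z) (hy : y ∈ Z) : d x = d y := by
  have : PreconnectedSpace Z := isPreconnected_iff_preconnectedSpace.1 hZ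
  have hc : c ≠ 0 := (h x hx) ▸ Complex.exp_ne_zero _
  have key := Complex.isCoveringMap_exp.eq_of_comp_eq
    (g₁ := fun z : Z ↦ d z) (g₂ := fun _ : Z ↦ d x)
    (continuousOn_iff_continuous_domRestrict.1 hd) continuous_const
    (by ext z; simp [h z z.2, h x hx]) ⟨x, hx⟩ rfl
  exact (congrFun key ⟨y, hy⟩).symm

/-- Two logarithms of one function on a preconnected set differ by a constant. -/
theorem log_sub_log_const {X : Type*} [TopologicalSpace X] {Z : Set X}
    (hZ : IsPreconnected Z) {a b : X → ℂ} (ha : ContinuousOn a Z) (hb : ContinuousOn b Z) {c : ℂ}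
    (h : ∀ x ∈ Z, Complex.exp (a x) = c * Complex.exp (b x)) {x y : X} (hx : x ∈ Z) (hy : y ∈ Z) :
    a x - b x = a y - b y := by
  refine eq_of_exp_eq_of_isPreconnected hZ (d := fun x ↦ a x - b x) (c := c) (ha.sub hb) ?_ hx hy
  intro z hz
  rw [Complex.exp_sub, h z hz, mul_div_cancel_right₀ _ (Complex.exp_ne_zero _)]

/-- The difference quotient of `h` admits a continuous symmetric logarithm. For a homeomorphism
of the plane this says that `h` preserves the orientation. -/
def HasSymmLog (h : ℂ → ℂ) : Prop :=
  ∃ l : ℂ × ℂ → ℂ, ContinuousOn l {p | p.1 ≠ p.2} ∧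
    (∀ p : ℂ × ℂ, p.1 ≠ p.2 → Complex.exp (l p) * (p.1 - p.2) = h p.1 - h p.2) ∧
    ∀ x y, x ≠ y → l (x, y) = l (y, x)

/-- A translation curve of a fixed point free orientation preserving map cannot close up. -/
theorem translationCurve_ne {h : ℂ → ℂ} (hc : Continuous h) (hl : HasSymmLog h)
    (hfix : ∀ z, h z ≠ z) {γ : ℝ → ℂ} (hγ : Continuous γ) (hs : ∀ s, h (γ s) = γ (s + 1))
    {m : ℝ} (hm : 1 < m) (hinj : ∀ s t, s < t → t < s + m → γ s ≠ γ t) : γ 0 ≠ γ m := by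
  intro h0m
  obtain ⟨l, lc, le, lsymm⟩ := hl
  set E : Set (ℝ × ℝ) := {p | p.1 < p.2 ∧ p.2 < p.1 + m} with hE
  have hEc : Convex ℝ E := by
    intro p hp q hq a b ha hb hab
    simp only [hE, mem_ofPred_eq, Prod.fst_add, Prod.smul_fst, smul_eq_mul, Prod.snd_add,
      Prod.smul_snd] at hp hq ⊢
    rcases ha.eq_or_lt with rfl | ha
    · obtain rfl : b = 1 := by linarith
      constructor <;> linarith [hq.1, hq.2]
    constructor
    · nlinarith [mul_pos ha (sub_pos.2 hp.1), mul_nonneg hb (sub_pos.2 hq.1).le]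
    · have h1 := mul_pos ha (sub_pos.2 hp.2)
      have h2 := mul_nonneg hb (sub_pos.2 hq.2).le
      obtain rfl : b = 1 - a := by linarith
      nlinarith
  have h01 : ((0 : ℝ), (1 : ℝ)) ∈ E := ⟨by norm_num, by simpa using hm⟩
  obtain ⟨A, Ac, Ae⟩ := exists_continuousOn_log (hEc.starConvex h01) h01
    (g := fun p : ℝ × ℝ ↦ γ p.2 - γ p.1) (by fun_prop)
    (fun p hp ↦ sub_ne_zero.2 (hinj _ _ hp.1 hp.2).symm)
  obtain ⟨Θ, Θc, Θe⟩ := exists_continuousOn_log (convex_univ.starConvex (mem_univ (0 : ℂ)))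
    (mem_univ _) (g := fun z ↦ h z - z) (by fun_prop) (fun z _ ↦ sub_ne_zero.2 (hfix z))
  have hΘ : A (0, 1) = A (m, m + 1) := by
    have key := log_sub_log_const (Z := univ) isPreconnected_univ
      (a := fun s : ℝ ↦ Θ (γ s)) (b := fun s ↦ A (s, s + 1)) (c := 1)
      (Θc.comp hγ.continuousOn fun _ _ ↦ mem_univ _)
      (Ac.comp (by fun_prop) fun s _ ↦ ⟨by simp, by simpa using hm⟩)
      (fun s _ ↦ by
        rw [Θe _ (mem_univ _), Ae _ ⟨by simp, by simpa using hm⟩, one_mul, hs])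
      (mem_univ 0) (mem_univ m)
    simp only [h0m, zero_add] at key
    exact sub_right_injective key
  have hA0 : ∀ s ∈ Ioo 0 m, ((0 : ℝ), s) ∈ E ∧ (s, m) ∈ E := fun s hs ↦
    ⟨⟨hs.1, by simpa using hs.2⟩, ⟨hs.2, by linarith [hs.1]⟩⟩
  have hA1 : ∀ s ∈ Ioo 1 (m + 1), ((1 : ℝ), s) ∈ E ∧ (s, m + 1) ∈ E := fun s hs ↦
    ⟨⟨hs.1, by simp only; linarith [hs.2]⟩, ⟨hs.2, by simp only; linarith [hs.1]⟩⟩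
  have h1m : γ (m + 1) = γ 1 := by rw [← hs m, ← h0m, hs 0, zero_add]
  have hD : ∀ s ∈ Ioo 0 m, ∀ t ∈ Ioo 0 m, A (0, s) - A (s, m) = A (0, t) - A (t, m) :=
    fun s hs t ht ↦ log_sub_log_const isPreconnected_Ioo
      (a := fun s : ℝ ↦ A (0, s)) (b := fun s ↦ A (s, m)) (c := -1)
      (Ac.comp (by fun_prop) fun s hs ↦ (hA0 s hs).1)
      (Ac.comp (by fun_prop) fun s hs ↦ (hA0 s hs).2)
      (fun s hs ↦ by rw [Ae _ (hA0 s hs).1, Ae _ (hA0 s hs).2, ← h0m]; ring) hs ht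
  have hD' : ∀ s ∈ Ioo 1 (m + 1), ∀ t ∈ Ioo 1 (m + 1),
      A (1, s) - A (s, m + 1) = A (1, t) - A (t, m + 1) :=
    fun s hs t ht ↦ log_sub_log_const isPreconnected_Ioo
      (a := fun s : ℝ ↦ A (1, s)) (b := fun s ↦ A (s, m + 1)) (c := -1)
      (Ac.comp (by fun_prop) fun s hs ↦ (hA1 s hs).1)
      (Ac.comp (by fun_prop) fun s hs ↦ (hA1 s hs).2)
      (fun s hs ↦ by rw [Ae _ (hA1 s hs).1, Ae _ (hA1 s hs).2, h1m]; ring) hs ht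
  have hshift : ∀ p ∈ E, (p.1 + 1, p.2 + 1) ∈ E := fun p hp ↦
    ⟨by simpa using hp.1, by simp only; linarith [hp.2]⟩
  have hne : ∀ p ∈ E, γ p.2 ≠ γ p.1 := fun p hp ↦ (hinj _ _ hp.1 hp.2).symm
  have hK : ∀ p ∈ E, ∀ q ∈ E, l (γ p.2, γ p.1) + A p - A (p.1 + 1, p.2 + 1) =
      l (γ q.2, γ q.1) + A q - A (q.1 + 1, q.2 + 1) :=
    fun p hp q hq ↦ log_sub_log_const hEc.isPreconnected
      (a := fun p : ℝ × ℝ ↦ l (γ p.2, γ p.1) + A p) (b := fun p ↦ A (p.1 + 1, p.2 + 1)) (c := 1)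
      ((lc.comp (by fun_prop) fun p hp ↦ hne p hp).add Ac)
      (Ac.comp (by fun_prop) hshift)
      (fun p hp ↦ by
        rw [Complex.exp_add, Ae _ hp, Ae _ (hshift p hp), one_mul, le (γ p.2, γ p.1) (hne p hp)]
        simp only [hs]) hp hq
  have hm2 : m / 2 ∈ Ioo 0 m := ⟨by linarith, by linarith⟩
  have e1 := hK _ (hA0 _ hm2).1 _ (hA0 _ hm2).2
  simp only [zero_add] at e1
  rw [← h0m, lsymm (γ 0) (γ (m / 2)) (hinj 0 (m / 2) hm2.1 (by linarith))] at e1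
  have e2 := hD _ hm2 1 ⟨by norm_num, hm⟩
  have e3 := hD' (m / 2 + 1) ⟨by linarith, by linarith⟩ m ⟨hm, by linarith⟩
  have hD0 : A (0, 1) - A (1, m) = 0 := by linear_combination (e1 - e2 + e3 + hΘ) / 2
  have hexp : Complex.exp (A (0, 1)) = -Complex.exp (A (1, m)) := by
    have hx := hA0 1 ⟨by norm_num, hm⟩
    rw [Ae _ hx.1, Ae _ hx.2, ← h0m]; ring
  rw [sub_eq_zero.1 hD0] at hexp
  exact Complex.exp_ne_zero _ (self_eq_neg.1 hexp)

/-- The curve obtained by iterating `h` on an arc from `α 0` to `α 1 = h (α 0)`. -/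
def iterCurve (h : ℂ ≃ₜ ℂ) (α : ℝ → ℂ) (s : ℝ) : ℂ := (h ^ ⌊s⌋) (α (Int.fract s))

theorem iterCurve_add_int (h : ℂ ≃ₜ ℂ) (α : ℝ → ℂ) (s : ℝ) (n : ℤ) :
    iterCurve h α (s + n) = (h ^ n) (iterCurve h α s) := by
  simp only [iterCurve, Int.floor_add_intCast, Int.fract_add_intCast]
  rw [add_comm, zpow_add]; rfl

theorem iterCurve_add_one (h : ℂ ≃ₜ ℂ) (α : ℝ → ℂ) (s : ℝ) :
    iterCurve h α (s + 1) = h (iterCurve h α s) := by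
  simpa using iterCurve_add_int h α s 1

theorem iterCurve_of_mem_Ico (h : ℂ ≃ₜ ℂ) (α : ℝ → ℂ) {s : ℝ} (hs : s ∈ Ico (0 : ℝ) 1) :
    iterCurve h α s = α s := by
  have h0 : ⌊s⌋ = 0 := Int.floor_eq_zero_iff.2 hs
  simp only [iterCurve, h0, Int.fract_eq_self.2 hs, zpow_zero]; rfl

theorem continuous_iterCurve (h : ℂ ≃ₜ ℂ) {α : ℝ → ℂ} (hα : Continuous α) (h1 : α 1 = h (α 0)) :
    Continuous (iterCurve h α) := by
  have hIcc : ∀ s ∈ Icc (0 : ℝ) 1, iterCurve h α s = α s := by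
    intro s hs
    rcases hs.2.eq_or_lt with rfl | hlt
    · have := iterCurve_add_one h α 0
      rw [iterCurve_of_mem_Ico h α ⟨le_rfl, one_pos⟩, zero_add] at this
      rw [this, h1]
    · exact iterCurve_of_mem_Ico h α ⟨hs.1, hlt⟩
  have hpiece : ∀ n : ℤ, ContinuousOn (iterCurve h α) (Icc (n : ℝ) (n + 1)) := by
    intro n
    have : ContinuousOn (fun s : ℝ ↦ (h ^ n) (α (s - n))) (Icc (n : ℝ) (n + 1)) :=
      ((h ^ n).continuous.comp (hα.comp (by fun_prop))).continuousOn
    refine this.congr fun s hs ↦ ?_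
    have e := iterCurve_add_int h α (s - n) n
    rwa [sub_add_cancel, hIcc (s - n) ⟨by linarith [hs.1], by linarith [hs.2]⟩] at e
  refine continuous_iff_continuousAt.2 fun s ↦ ?_
  have hcov : Icc ((⌊s⌋ - 1 : ℤ) : ℝ) ((⌊s⌋ - 1 : ℤ) + 1) ∪ Icc (⌊s⌋ : ℝ) (⌊s⌋ + 1) ∈ nhds s := by
    refine Filter.mem_of_superset (Ioo_mem_nhds (a := (⌊s⌋ : ℝ) - 1) (b := ⌊s⌋ + 1)
      (by linarith [Int.floor_le s]) (Int.lt_floor_add_one s)) ?_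
    rintro t ⟨h1, h2⟩
    rcases le_total t ⌊s⌋ with h | h
    · left; push_cast; exact ⟨h1.le, by linarith⟩
    · right; exact ⟨h, h2.le⟩
  exact ((hpiece _).union_of_isClosed (hpiece _) isClosed_Icc isClosed_Icc).continuousAt hcov

/-- Brouwer's lemma: a fixed point free orientation preserving homeomorphism of the plane has no
periodic point. -/
theorem iterate_ne_of_fixedPointFree (h : ℂ ≃ₜ ℂ) (hl : HasSymmLog h) (hfix : ∀ z, h z ≠ z)
    (x : ℂ) {n : ℕ} (hn : n ≠ 0) : h^[n] x ≠ x := by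
  intro hper
  -- the largest free open ball centred at `x`
  obtain ⟨y', hy'⟩ : ∃ y', ∀ z, max (dist y' x) (dist (h y') x) ≤ max (dist z x) (dist (h z) x) := by
    refine Continuous.exists_forall_le (by fun_prop) ?_
    exact Filter.tendsto_atTop_mono (fun z ↦ le_max_left _ _) (tendsto_dist_right_cocompact_atTop x)
  set r := max (dist y' x) (dist (h y') x) with hr
  have hr0 : 0 < r := by
    rcases (le_max_of_le_left dist_nonneg : 0 ≤ r).eq_or_lt with h0 | h0
    · have h1 : y' = x := dist_le_zero.1 (h0 ▸ le_max_left _ _)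
      have h2 : h y' = x := dist_le_zero.1 (h0 ▸ le_max_right _ _)
      exact absurd (h2.trans h1.symm) (hfix y')
    · exact h0
  have hout : ∀ U : Set ℂ, IsOpen U → (∀ w ∈ U, r ≤ dist w x) → ∀ w ∈ U, r < dist w x := by
    intro U hU hUr w hw
    have hsub : U ⊆ interior (Metric.ball x r)ᶜ :=
      interior_maximal (fun w hw ↦ by simpa using hUr w hw) hU
    have := hsub hw
    rw [interior_compl, closure_ball _ hr0.ne'] at this
    simpa using this
  have hfwd : ∀ z, dist z x < r → r < dist (h z) x := by
    intro z hz
    refine hout (h '' Metric.ball x r) (h.isOpenMap _ Metric.isOpen_ball) ?_ _ ⟨z, hz, rfl⟩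
    rintro _ ⟨u, hu, rfl⟩
    exact (le_max_iff.1 (hy' u)).resolve_left (not_le.2 hu)
  have hbwd : ∀ z, dist (h z) x < r → r < dist z x := by
    intro z hz
    refine hout (h ⁻¹' Metric.ball x r) (Metric.isOpen_ball.preimage h.continuous) ?_ _ hz
    intro u hu
    exact (le_max_iff.1 (hy' u)).resolve_right (not_le.2 hu)
  have hy'r : dist y' x = r := by
    refine (le_max_left _ _).antisymm (not_lt.1 fun hlt ↦ ?_)
    exact (hfwd _ hlt).not_ge (le_max_right _ _)
  have hyr : dist (h y') x = r := by
    refine (le_max_right _ _).antisymm (not_lt.1 fun hlt ↦ ?_)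
    exact (hbwd _ hlt).not_ge (le_max_left _ _)
  set y := h y' with hy
  have hyy : y' ≠ y := (hfix y').symm
  -- the translation arc
  set α : ℝ → ℂ := fun s ↦
    x + ((max 0 (1 - 2 * s) : ℝ) : ℂ) * (y' - x) + ((max 0 (2 * s - 1) : ℝ) : ℂ) * (y - x) with hα
  have hαc : Continuous α := by
    rw [hα]
    fun_prop
  have hαl : ∀ s ≤ 1 / 2, α s = x + ((1 - 2 * s : ℝ) : ℂ) * (y' - x) := fun s hs ↦ by
    simp only [hα]
    rw [max_eq_right (by linarith : (0 : ℝ) ≤ 1 - 2 * s),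
      max_eq_left (by linarith : 2 * s - 1 ≤ (0 : ℝ))]
    simp
  have hαr : ∀ s ≥ 1 / 2, α s = x + ((2 * s - 1 : ℝ) : ℂ) * (y - x) := fun s hs ↦ by
    simp only [hα]
    rw [max_eq_left (by linarith : 1 - 2 * s ≤ (0 : ℝ)),
      max_eq_right (by linarith : (0 : ℝ) ≤ 2 * s - 1)]
    simp
  have hα0 : α 0 = y' := by rw [hαl 0 (by norm_num)]; simp
  have hα1 : α 1 = y := by rw [hαr 1 (by norm_num)]; norm_num
  have hαh : α (1 / 2) = x := by rw [hαl _ le_rfl]; norm_num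
  have hαd : ∀ s, dist (α s) x = |1 - 2 * s| * r := by
    intro s
    rcases le_total s (1 / 2) with hs | hs
    · rw [hαl s hs, dist_eq_norm, add_sub_cancel_left, norm_mul, Complex.norm_real,
        Real.norm_eq_abs, ← dist_eq_norm, hy'r]
    · rw [hαr s hs, dist_eq_norm, add_sub_cancel_left, norm_mul, Complex.norm_real,
        Real.norm_eq_abs, ← dist_eq_norm, hyr, abs_sub_comm]
  have hαinj : ∀ s t, s < t → α s ≠ α t := by
    intro s t hst heq
    have hd : |1 - 2 * s| = |1 - 2 * t| := by
      have := hαd s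
      rw [heq, hαd t] at this
      exact (mul_right_cancel₀ hr0.ne' this).symm
    rcases abs_eq_abs.1 hd with h1 | h1
    · linarith
    · rw [hαl s (by linarith), hαr t (by linarith),
        show (2 * t - 1 : ℝ) = 1 - 2 * s by linarith] at heq
      have hne : ((1 - 2 * s : ℝ) : ℂ) ≠ 0 := by
        rw [Complex.ofReal_ne_zero]; intro h; linarith
      exact hyy (sub_left_injective (mul_left_cancel₀ hne (add_left_cancel heq)))
  set γ := iterCurve h α with hγ
  have hγc : Continuous γ := continuous_iterCurve h hαc (by rw [hα1, hα0])
  have hγ1 : ∀ s, h (γ s) = γ (s + 1) := fun s ↦ (iterCurve_add_one h α s).symm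
  -- near returns are impossible
  have hret : ∀ s t, s < t → γ s = γ t → s + 1 < t := by
    intro s t hst heq
    by_contra! hle
    set n := ⌊s⌋ with hn
    have hs0 : 0 ≤ s - n := by linarith [Int.floor_le s]
    have hs1 : s - n < 1 := by linarith [Int.lt_floor_add_one s]
    have heq' : γ (s - n) = γ (t - n) := by
      apply (h ^ n).injective
      rw [hγ, ← iterCurve_add_int, ← iterCurve_add_int]
      simpa using heq
    rw [hγ, iterCurve_of_mem_Ico h α ⟨hs0, hs1⟩] at heq'
    rcases lt_or_ge (t - n) 1 with ht | ht
    · rw [iterCurve_of_mem_Ico h α ⟨by linarith, ht⟩] at heq'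
      exact hαinj _ _ (by linarith) heq'
    · have e := iterCurve_add_one h α (t - n - 1)
      rw [sub_add_cancel, iterCurve_of_mem_Ico h α (s := t - n - 1) ⟨by linarith, by linarith⟩] at e
      rw [e] at heq'
      rcases ht.eq_or_lt with h1 | h1
      · rw [← h1, sub_self, hα0] at heq'
        exact hαinj _ _ hs1 (heq'.trans hα1.symm)
      · have hin : dist (α (t - n - 1)) x < r := by
          rw [hαd]
          refine mul_lt_of_lt_one_left hr0 (abs_lt.2 ⟨by linarith, by linarith⟩)
        have h2 := hfwd _ hin
        rw [← heq', hαd] at h2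
        exact h2.not_ge (mul_le_of_le_one_left hr0.le (abs_le.2 ⟨by linarith, by linarith⟩))
  -- the shortest return
  have hcomp : IsCompact ((Icc (0 : ℝ) 1 ×ˢ Icc (1 : ℝ) n) ∩ {p | γ p.1 = γ (p.1 + p.2)}) :=
    (isCompact_Icc.prod isCompact_Icc).inter_right (isClosed_eq (by fun_prop) (by fun_prop))
  have hn1 : (1 : ℝ) ≤ n := by exact_mod_cast Nat.one_le_iff_ne_zero.2 hn
  have hne : ((Icc (0 : ℝ) 1 ×ˢ Icc (1 : ℝ) n) ∩ {p | γ p.1 = γ (p.1 + p.2)}).Nonempty := by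
    refine ⟨(1 / 2, n), ⟨⟨by norm_num, by norm_num⟩, ⟨hn1, le_rfl⟩⟩, ?_⟩
    have e := iterCurve_add_int h α (1 / 2) n
    have e' : iterCurve h α (1 / 2) = x := by
      rw [iterCurve_of_mem_Ico h α ⟨by norm_num, by norm_num⟩, hαh]
    simp only [mem_ofPred_eq, hγ]
    push_cast at e
    rw [e, e', zpow_natCast]
    have : ∀ k : ℕ, (h ^ k) x = h^[k] x := fun k ↦ by
      induction k with
      | zero => rfl
      | succ k ih => rw [pow_succ', Function.iterate_succ_apply', ← ih]; rfl
    rw [this, hper]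
  obtain ⟨⟨a, m⟩, ⟨⟨ha, hm⟩, ham⟩, hmin⟩ := hcomp.exists_isMinOn hne continuous_snd.continuousOn
  simp only at ha hm ham
  have hm1 : 1 < m := by
    have := hret a (a + m) (by linarith [hm.1]) ham
    linarith
  refine translationCurve_ne h.continuous hl hfix (γ := fun s ↦ γ (s + a)) (by fun_prop)
    (fun s ↦ by rw [hγ1]; ring_nf) hm1 ?_ (by simpa [add_comm] using ham)
  intro s t hst htm heq
  have hfl0 := Int.floor_le (s + a)
  have hfl1 := Int.lt_floor_add_one (s + a)
  have h1 : s + a + 1 < t + a := hret _ _ (by linarith) heq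
  have hmem : (s + a - ⌊s + a⌋, t - s) ∈
      (Icc (0 : ℝ) 1 ×ˢ Icc (1 : ℝ) n) ∩ {p | γ p.1 = γ (p.1 + p.2)} := by
    refine ⟨⟨⟨by simp only; linarith, by simp only; linarith⟩,
      ⟨by simp only; linarith, by simp only; linarith [hm.2]⟩⟩, ?_⟩
    simp only [mem_ofPred_eq]
    apply (h ^ ⌊s + a⌋).injective
    rw [hγ, ← iterCurve_add_int, ← iterCurve_add_int]
    rw [show s + a - (⌊s + a⌋ : ℝ) + (t - s) + (⌊s + a⌋ : ℝ) = t + a by ring, sub_add_cancel]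
    exact heq
  have := hmin hmem
  simp only [mem_ofPred_eq] at this
  linarith

theorem HasSymmLog.comp {h φ : ℂ → ℂ} (hh : HasSymmLog h) (hφ : HasSymmLog φ)
    (hc : Continuous φ) (hi : Function.Injective φ) : HasSymmLog (h ∘ φ) := by
  obtain ⟨l, lc, le, ls⟩ := hh
  obtain ⟨m, mc, me, ms⟩ := hφ
  refine ⟨fun p ↦ l (φ p.1, φ p.2) + m p, ?_, fun p hp ↦ ?_, fun x y hxy ↦ ?_⟩
  · refine (lc.comp (t := {p : ℂ × ℂ | p.1 ≠ p.2}) (by fun_prop) fun p hp ↦ ?_).add mc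
    exact hi.ne hp
  · have h1 := le (φ p.1, φ p.2) (hi.ne hp)
    rw [Complex.exp_add, mul_assoc, me p hp]
    exact h1
  · simp only [ms x y hxy, ls (φ x) (φ y) (hi.ne hxy)]

theorem HasSymmLog.of_mem_slitPlane {h : ℂ → ℂ} (hc : Continuous h)
    (hs : ∀ x y, x ≠ y → (h x - h y) / (x - y) ∈ Complex.slitPlane) : HasSymmLog h := by
  refine ⟨fun p ↦ Complex.log ((h p.1 - h p.2) / (p.1 - p.2)), ?_, fun p hp ↦ ?_, fun x y _ ↦ ?_⟩
  · refine ContinuousOn.clog ?_ fun p hp ↦ hs _ _ hp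
    exact ContinuousOn.div (by fun_prop) (by fun_prop) fun p hp ↦ sub_ne_zero.2 hp
  · rw [Complex.exp_log (Complex.slitPlane_ne_zero (hs _ _ hp)),
      div_mul_cancel₀ _ (sub_ne_zero.2 hp)]
  · simp only
    rw [← neg_sub (h y), ← neg_sub y, neg_div_neg_eq]

theorem HasSymmLog.symm {φ : ℂ ≃ₜ ℂ} (hφ : HasSymmLog φ) : HasSymmLog φ.symm := by
  obtain ⟨m, mc, me, ms⟩ := hφ
  refine ⟨fun p ↦ -m (φ.symm p.1, φ.symm p.2), ?_, fun p hp ↦ ?_, fun x y hxy ↦ ?_⟩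
  · refine (mc.comp (t := {p : ℂ × ℂ | p.1 ≠ p.2}) (by fun_prop) fun p hp ↦ ?_).neg
    exact φ.symm.injective.ne hp
  · have h1 := me (φ.symm p.1, φ.symm p.2) (φ.symm.injective.ne hp)
    simp only [Homeomorph.apply_symm_apply] at h1
    rw [← h1, ← mul_assoc, ← Complex.exp_add, neg_add_cancel, Complex.exp_zero, one_mul]
  · simp only [ms _ _ (φ.symm.injective.ne hxy)]

theorem hasSymmLog_id : HasSymmLog id :=
  .of_mem_slitPlane continuous_id fun x y h ↦ by
    simp [div_self (sub_ne_zero.2 h)]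

theorem exists_homeomorph_move_small {p q : ℂ} {r : ℝ} (hr : 0 < r) (hpq : ‖q - p‖ ≤ r / 2) :
    ∃ φ : ℂ ≃ₜ ℂ, HasSymmLog φ ∧ (∀ z ∉ Metric.ball p r, φ z = z) ∧ φ p = q := by
  let u : ℂ → ℂ := fun z ↦ ((max 0 (1 - ‖z - p‖ / r) : ℝ) : ℂ) * (q - p)
  have hu : ∀ x y, ‖u x - u y‖ ≤ 1 / 2 * ‖x - y‖ := by
    intro x y
    have e : u x - u y
        = ((max 0 (1 - ‖x - p‖ / r) - max 0 (1 - ‖y - p‖ / r) : ℝ) : ℂ) * (q - p) := by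
      simp only [u]; push_cast; ring
    rw [e, norm_mul, Complex.norm_real, Real.norm_eq_abs]
    have h1 : |max 0 (1 - ‖x - p‖ / r) - max 0 (1 - ‖y - p‖ / r)| ≤ ‖x - y‖ / r := by
      refine (abs_max_sub_max_le_max _ _ _ _).trans ?_
      rw [sub_self, abs_zero, max_eq_right (abs_nonneg _)]
      have : 1 - ‖x - p‖ / r - (1 - ‖y - p‖ / r) = (‖y - p‖ - ‖x - p‖) / r := by ring
      rw [this, abs_div, abs_of_pos hr]
      gcongr
      refine (abs_norm_sub_norm_le _ _).trans_eq ?_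
      rw [← norm_neg]; congr 1; ring
    calc _ ≤ ‖x - y‖ / r * (r / 2) := by gcongr
      _ = _ := by field_simp
  let φ : ℂ → ℂ := fun z ↦ z + u z
  have hL : ApproximatesLinearOn φ ((ContinuousLinearEquiv.refl ℝ ℂ : ℂ ≃L[ℝ] ℂ) : ℂ →L[ℝ] ℂ)
      univ (1 / 2 : NNReal) := by
    intro x _ y _
    have e : φ x - φ y - (x - y) = u x - u y := by simp only [φ]; ring
    simpa [e] using hu x y
  have hcN : (1 / 2 : NNReal) < ‖(((ContinuousLinearEquiv.refl ℝ ℂ).symm : ℂ ≃L[ℝ] ℂ) : ℂ →L[ℝ] ℂ)‖₊⁻¹ := by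
    have : ‖(((ContinuousLinearEquiv.refl ℝ ℂ).symm : ℂ ≃L[ℝ] ℂ) : ℂ →L[ℝ] ℂ)‖₊ = 1 := by
      rw [← NNReal.coe_inj]
      exact ContinuousLinearMap.norm_id
    rw [this, inv_one]
    exact NNReal.half_lt_self one_ne_zero
  let Φ := hL.toHomeomorph φ (Or.inr hcN)
  have hΦ : ∀ z, Φ z = z + u z := fun z ↦ rfl
  refine ⟨Φ, .of_mem_slitPlane Φ.continuous fun x y hxy ↦ ?_, fun z hz ↦ ?_, ?_⟩
  · have hxy' := sub_ne_zero.2 hxy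
    have e : (Φ x - Φ y) / (x - y) = 1 + (u x - u y) / (x - y) := by
      rw [hΦ, hΦ]; field_simp; ring
    have h2 : ‖(u x - u y) / (x - y)‖ ≤ 1 / 2 := by
      rw [norm_div, div_le_iff₀ (norm_pos_iff.2 hxy')]
      exact hu x y
    left
    have := (abs_le.1 ((Complex.abs_re_le_norm _).trans h2)).1
    rw [e, Complex.add_re, Complex.one_re]
    linarith
  · rw [Metric.mem_ball, dist_eq_norm, not_lt] at hz
    have : 1 ≤ ‖z - p‖ / r := by rwa [le_div_iff₀ hr, one_mul]
    rw [hΦ]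
    simp only [u]
    rw [max_eq_left (by linarith)]
    simp
  · rw [hΦ]; simp [u]

theorem apply_mem_of_eq_self_off {X : Type*} {φ : X → X} (hi : Function.Injective φ) {D : Set X}
    (h : ∀ z ∉ D, φ z = z) {z : X} (hz : z ∈ D) : φ z ∈ D := by
  by_contra hn
  exact hn (by rwa [hi (h _ hn)])

theorem exists_homeomorph_move {D : Set ℂ} (hD : IsOpen D) (hDc : IsPreconnected D) {p q : ℂ}
    (hp : p ∈ D) (hq : q ∈ D) :
    ∃ φ : ℂ ≃ₜ ℂ, HasSymmLog φ ∧ (∀ z ∉ D, φ z = z) ∧ φ p = q := by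
  refine hDc.induction₂ (fun p q ↦ ∃ φ : ℂ ≃ₜ ℂ, HasSymmLog φ ∧ (∀ z ∉ D, φ z = z) ∧ φ p = q)
    (fun x hx ↦ ?_) ?_ ?_ hp hq
  · obtain ⟨r, hr, hrD⟩ := Metric.isOpen_iff.1 hD x hx
    refine mem_nhdsWithin_of_mem_nhds (Filter.mem_of_superset
      (Metric.closedBall_mem_nhds x (half_pos hr)) fun y hy ↦ ?_)
    rw [Metric.mem_closedBall, dist_eq_norm] at hy
    obtain ⟨φ, h1, h2, h3⟩ := exists_homeomorph_move_small hr hy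
    exact ⟨φ, h1, fun z hz ↦ h2 z fun h ↦ hz (hrD h), h3⟩
  · rintro x y z _ _ _ ⟨φ, h1, h2, h3⟩ ⟨ψ, k1, k2, k3⟩
    refine ⟨φ.trans ψ, k1.comp h1 φ.continuous φ.injective, fun z hz ↦ ?_, ?_⟩
    · rw [Homeomorph.trans_apply, h2 z hz, k2 z hz]
    · rw [Homeomorph.trans_apply, h3, k3]
  · rintro x y _ _ ⟨φ, h1, h2, h3⟩
    exact ⟨φ.symm, h1.symm, fun z hz ↦ by rw [Homeomorph.symm_apply_eq, h2 z hz],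
      by rw [Homeomorph.symm_apply_eq, h3]⟩

theorem exists_homeomorph_move_family {ι : Type*} (s : Finset ι) {D : ι → Set ℂ}
    (hD : ∀ i ∈ s, IsOpen (D i)) (hDc : ∀ i ∈ s, IsPreconnected (D i))
    (hdis : (s : Set ι).PairwiseDisjoint D) {p q : ι → ℂ}
    (hp : ∀ i ∈ s, p i ∈ D i) (hq : ∀ i ∈ s, q i ∈ D i) :
    ∃ φ : ℂ ≃ₜ ℂ, HasSymmLog φ ∧ (∀ z, (∀ i ∈ s, z ∉ D i) → φ z = z) ∧
      (∀ i ∈ s, ∀ z ∈ D i, φ z ∈ D i) ∧ ∀ i ∈ s, φ (p i) = q i := by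
  classical
  induction s using Finset.induction_on with
  | empty => exact ⟨Homeomorph.refl ℂ, hasSymmLog_id, by simp, by simp, by simp⟩
  | insert a s ha ih =>
    simp only [Finset.mem_insert, forall_eq_or_imp] at hD hDc hp hq
    rw [Finset.coe_insert] at hdis
    obtain ⟨φ, h1, h2, h3, h4⟩ := ih hD.2 hDc.2 (hdis.subset (subset_insert _ _)) hp.2 hq.2
    obtain ⟨ψ, k1, k2, k3⟩ := exists_homeomorph_move hD.1 hDc.1 hp.1 hq.1
    have hna : ∀ i ∈ s, ∀ z ∈ D i, z ∉ D a := fun i hi z hz hz' ↦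
      (disjoint_left.1 (hdis (mem_insert _ _) (mem_insert_of_mem _ hi)
        (fun h ↦ ha (h ▸ hi)))) hz' hz
    refine ⟨ψ.trans φ, h1.comp k1 ψ.continuous ψ.injective, fun z hz ↦ ?_, fun i hi z hz ↦ ?_,
      fun i hi ↦ ?_⟩
    · rw [Homeomorph.trans_apply, k2 z (hz a (Finset.mem_insert_self _ _)),
        h2 z fun i hi ↦ hz i (Finset.mem_insert_of_mem hi)]
    · rw [Homeomorph.trans_apply]
      rcases Finset.mem_insert.1 hi with rfl | hi
      · have := apply_mem_of_eq_self_off ψ.injective k2 hz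
        rwa [h2 _ fun j hj hz' ↦ hna j hj _ hz' this]
      · rw [k2 z (hna i hi z hz)]
        exact h3 i hi z hz
    · rw [Homeomorph.trans_apply]
      rcases Finset.mem_insert.1 hi with rfl | hi
      · rw [k3, h2 _ fun j hj hz' ↦ hna j hj _ hz' hq.1]
      · rw [k2 _ (hna i hi _ (hp.2 i hi)), h4 i hi]

/-- Franks' lemma: a fixed point free homeomorphism has no periodic chain of free disks. -/
theorem false_of_periodic_diskChain (h : ℂ ≃ₜ ℂ) (hl : HasSymmLog h) (hfix : ∀ z, h z ≠ z)
    {n : ℕ} (hn : n ≠ 0) (D : ℕ → Set ℂ) (hD : ∀ i < n, IsOpen (D i))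
    (hDc : ∀ i < n, IsPreconnected (D i)) (hfree : ∀ i < n, ∀ z ∈ D i, h z ∉ D i)
    (hdis : ∀ i < n, ∀ j < n, i ≠ j → Disjoint (D i) (D j))
    (hch : ∀ i < n, ∃ z ∈ D i, h z ∈ D ((i + 1) % n)) : False := by
  choose! x hx hx' using hch
  have hpos : 0 < n := Nat.pos_of_ne_zero hn
  let p : ℕ → ℂ := fun i ↦ h (x ((i + n - 1) % n))
  have hpx : ∀ i < n, p ((i + 1) % n) = h (x i) := by
    intro i hi
    have : ((i + 1) % n + n - 1) % n = i := by
      rcases Nat.lt_or_ge (i + 1) n with h1 | h1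
      · rw [Nat.mod_eq_of_lt h1, show i + 1 + n - 1 = i + n by omega, Nat.add_mod_right,
          Nat.mod_eq_of_lt hi]
      · rw [show i + 1 = n by omega, Nat.mod_self, show 0 + n - 1 = i by omega,
          Nat.mod_eq_of_lt hi]
    simp only [p, this]
  have hpD : ∀ i < n, p i ∈ D i := by
    intro i hi
    have h1 := hx' ((i + n - 1) % n) (Nat.mod_lt _ hpos)
    rwa [Nat.mod_add_mod, show i + n - 1 + 1 = i + n by omega, Nat.add_mod_right,
      Nat.mod_eq_of_lt hi] at h1
  obtain ⟨φ, h1, h2, h3, h4⟩ := exists_homeomorph_move_family (Finset.range n) (D := D)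
    (p := p) (q := x) (fun i hi ↦ hD i (Finset.mem_range.1 hi))
    (fun i hi ↦ hDc i (Finset.mem_range.1 hi))
    (fun i hi j hj hij ↦ hdis i (by simpa using hi) j (by simpa using hj) hij)
    (fun i hi ↦ hpD i (Finset.mem_range.1 hi)) (fun i hi ↦ hx i (Finset.mem_range.1 hi))
  simp only [Finset.mem_range] at h2 h3 h4
  have hfix' : ∀ z, φ.trans h z ≠ z := by
    intro z hz
    rw [Homeomorph.trans_apply] at hz
    by_cases hzD : ∀ i < n, z ∉ D i
    · rw [h2 z hzD] at hz
      exact hfix z hz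
    · push Not at hzD
      obtain ⟨i, hi, hzi⟩ := hzD
      exact hfree i hi _ (h3 i hi z hzi) (by rwa [hz])
  refine iterate_ne_of_fixedPointFree (φ.trans h) (hl.comp h1 φ.continuous φ.injective) hfix'
    (p 0) hn ?_
  have key : ∀ k, (φ.trans h)^[k] (p 0) = p (k % n) := by
    intro k
    induction k with
    | zero => simp
    | succ k ih =>
      rw [Function.iterate_succ_apply', ih, Homeomorph.trans_apply, h4 _ (Nat.mod_lt _ hpos),
        ← hpx _ (Nat.mod_lt _ hpos), Nat.mod_add_mod]
  rw [key n, Nat.mod_self]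

/-- A free disk of a fixed point free homeomorphism is wandering. -/
theorem iterate_notMem_of_free (h : ℂ ≃ₜ ℂ) (hl : HasSymmLog h) (hfix : ∀ z, h z ≠ z)
    {D : Set ℂ} (hD : IsOpen D) (hDc : IsPreconnected D) (hfree : ∀ z ∈ D, h z ∉ D)
    {n : ℕ} (hn : n ≠ 0) {x : ℂ} (hx : x ∈ D) : h^[n] x ∉ D := by
  classical
  intro hxn
  have hex : ∃ n, n ≠ 0 ∧ ∃ x ∈ D, h^[n] x ∈ D := ⟨n, hn, x, hx, hxn⟩
  obtain ⟨hm0, y, hy, hmy⟩ := Nat.find_spec hex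
  have hmin := fun k (hk : k < Nat.find hex) ↦ Nat.find_min hex hk
  set m := Nat.find hex
  obtain ⟨φ, h1, h2, h3⟩ := exists_homeomorph_move hD hDc hmy hy
  have hfix' : ∀ z, φ.trans h z ≠ z := by
    intro z hz
    rw [Homeomorph.trans_apply] at hz
    by_cases hzD : z ∈ D
    · exact hfree _ (apply_mem_of_eq_self_off φ.injective h2 hzD) (by rwa [hz])
    · rw [h2 z hzD] at hz
      exact hfix z hz
  refine iterate_ne_of_fixedPointFree (φ.trans h) (hl.comp h1 φ.continuous φ.injective) hfix'
    (h^[m] y) hm0 ?_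
  have key : ∀ k, k + 1 ≤ m → (φ.trans h)^[k + 1] (h^[m] y) = h^[k + 1] y := by
    intro k
    induction k with
    | zero => intro _; simp [h3]
    | succ k ih =>
      intro hk
      rw [Function.iterate_succ_apply', ih (by omega), Homeomorph.trans_apply, h2,
        ← Function.iterate_succ_apply' h]
      exact fun h' ↦ hmin (k + 1) (by omega) ⟨by omega, y, hy, h'⟩
  obtain ⟨k, hk⟩ := Nat.exists_eq_succ_of_ne_zero hm0
  have := key k (by omega)
  rwa [← Nat.succ_eq_add_one, ← hk] at this

theorem mem_slitPlane_div_of_re {a b : ℂ} (ha : 0 < a.re) (hb : 0 < b.re) :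
    a / b ∈ Complex.slitPlane := by
  by_contra h
  rw [Complex.mem_slitPlane_iff, not_or, not_lt, not_not] at h
  have hb0 : b ≠ 0 := fun h0 ↦ by simp [h0] at hb
  have e : a.re = (a / b * b).re := by rw [div_mul_cancel₀ _ hb0]
  rw [Complex.mul_re, h.2] at e
  nlinarith [h.1]

theorem mem_slitPlane_div_of_im {a b : ℂ} (hab : 0 < a.im * b.im) :
    a / b ∈ Complex.slitPlane := by
  by_contra h
  rw [Complex.mem_slitPlane_iff, not_or, not_lt, not_not] at h
  have hb0 : b ≠ 0 := fun h0 ↦ by simp [h0] at hab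
  have e : a.im = (a / b * b).im := by rw [div_mul_cancel₀ _ hb0]
  rw [Complex.mul_im, h.2] at e
  rw [e] at hab
  nlinarith [h.1, mul_self_nonneg b.im]

theorem HasSymmLog.of_bounded_re {H : ℂ → ℂ} (hc : Continuous H) (hi : Function.Injective H)
    {M : ℝ} (hM : ∀ z, |(H z).re - z.re| ≤ M)
    (him : ∀ x y : ℂ, 1 ≤ x.im → y.im ≤ -1 → (H y).im < (H x).im) : HasSymmLog H := by
  let R : ℂ × ℂ → ℂ := fun p ↦ (H p.1 - H p.2) / (p.1 - p.2)
  have hRs : ∀ p : ℂ × ℂ, R p.swap = R p := by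
    intro p
    simp only [R, Prod.fst_swap, Prod.snd_swap]
    rw [← neg_sub (H p.1), ← neg_sub p.1, neg_div_neg_eq]
  have hRc : ContinuousOn R {p | p.1 ≠ p.2} :=
    ContinuousOn.div (by fun_prop) (by fun_prop) fun p hp ↦ sub_ne_zero.2 hp
  have hR0 : ∀ p : ℂ × ℂ, p.1 ≠ p.2 → R p ≠ 0 := fun p hp ↦
    div_ne_zero (sub_ne_zero.2 (hi.ne hp)) (sub_ne_zero.2 hp)
  let A : Set (ℂ × ℂ) := {p | p.1 - p.2 ∈ Complex.slitPlane}
  have hAo : IsOpen A := Complex.isOpen_slitPlane.preimage (by fun_prop)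
  have hAd : ∀ p ∈ A, p.1 ≠ p.2 := fun p hp h ↦
    Complex.slitPlane_ne_zero hp (sub_eq_zero.2 h)
  have hAs : StarConvex ℝ ((1, 0) : ℂ × ℂ) A := by
    intro p hp a b ha hb hab
    have := Complex.starConvex_one_slitPlane hp ha hb hab
    simp only [A, mem_ofPred_eq]
    convert this using 1
    simp only [Prod.smul_mk, Prod.fst_add, Prod.snd_add, Prod.smul_fst, Prod.smul_snd, smul_zero,
      smul_sub]
    ring
  obtain ⟨l, lc, le⟩ := exists_continuousOn_log hAs (by simp [A])
    (hRc.mono hAd) (fun p hp ↦ hR0 p (hAd p hp))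
  have hlog : ∀ Z : Set (ℂ × ℂ), Convex ℝ Z → (∀ p ∈ Z, p ∈ A) →
      (∀ p ∈ Z, R p ∈ Complex.slitPlane) → ∀ p ∈ Z, ∀ q ∈ Z,
      l p - Complex.log (R p) = l q - Complex.log (R q) := by
    intro Z hZ hZA hZR p hp q hq
    refine log_sub_log_const (c := 1) hZ.isPreconnected (lc.mono hZA)
      (ContinuousOn.clog (hRc.mono fun p hp ↦ hAd p (hZA p hp)) hZR) (fun p hp ↦ ?_) hp hq
    rw [le p (hZA p hp), Complex.exp_log (hR0 p (hAd p (hZA p hp))), one_mul]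
  have hM0 : 0 ≤ M := (abs_nonneg _).trans (hM 0)
  let x₀ : ℂ := ⟨2 * M + 1, 1⟩
  let y₀ : ℂ := ⟨0, -1⟩
  have im_pos : ∀ p : ℂ × ℂ, 0 < (p.1 - p.2).im → p ∈ A := fun p hp ↦ Or.inr hp.ne'
  have im_neg : ∀ p : ℂ × ℂ, (p.1 - p.2).im < 0 → p ∈ A := fun p hp ↦ Or.inr hp.ne
  have hE2 := hlog {p | p.1.im ≤ -1 ∧ 1 ≤ p.2.im}
    (((convex_halfSpace_im_le (-1 : ℝ)).prod (convex_halfSpace_im_ge (1 : ℝ))))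
    (fun p hp ↦ im_neg p (by rw [Complex.sub_im]; linarith [hp.1, hp.2]))
    (fun p hp ↦ mem_slitPlane_div_of_im (by
      rw [Complex.sub_im, Complex.sub_im]
      exact mul_pos_of_neg_of_neg (by linarith [him _ _ hp.2 hp.1]) (by linarith [hp.1, hp.2])))
  have hE3 := hlog {p | 2 * M < (p.1 - p.2).re}
    ((convex_halfSpace_re_gt (2 * M)).is_linear_preimage
      (f := fun p : ℂ × ℂ ↦ p.1 - p.2) ((LinearMap.fst ℝ ℂ ℂ - LinearMap.snd ℝ ℂ ℂ).isLinear))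
    (fun p hp ↦ Or.inl (by simp only [mem_ofPred_eq] at hp; linarith))
    (fun p hp ↦ mem_slitPlane_div_of_re (by
        simp only [mem_ofPred_eq, Complex.sub_re] at hp ⊢
        linarith [abs_le.1 (hM p.1), abs_le.1 (hM p.2)])
      (by simp only [mem_ofPred_eq] at hp; linarith))
  have hbase : l (x₀, y₀) = l (y₀, x₀) := by
    let p₁ : ℂ × ℂ := (x₀, y₀)
    let p₂ : ℂ × ℂ := (⟨2 * M + 1, -1⟩, ⟨0, 1⟩)
    have e1 : l p₁ - _ = l p₂ - _ := hE3 p₁ (by simp [p₁, x₀, y₀]) p₂ (by simp [p₂])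
    have e2 : l p₂ - _ = l p₁.swap - _ :=
      hE2 p₂ (by simp [p₂]) p₁.swap (by simp [p₁, x₀, y₀])
    have := e1.trans e2
    rw [hRs] at this
    exact sub_left_injective this
  have hup : ∀ p : ℂ × ℂ, 0 < (p.1 - p.2).im → l p = l p.swap := by
    intro p hp
    have hconv : Convex ℝ {p : ℂ × ℂ | 0 < (p.1 - p.2).im} :=
      (convex_halfSpace_im_gt (0 : ℝ)).is_linear_preimage
        (f := fun p : ℂ × ℂ ↦ p.1 - p.2) ((LinearMap.fst ℝ ℂ ℂ - LinearMap.snd ℝ ℂ ℂ).isLinear)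
    have hsw : ∀ p : ℂ × ℂ, 0 < (p.1 - p.2).im → p.swap ∈ A := fun p hp ↦
      im_neg _ (by simp only [Complex.sub_im, Prod.fst_swap, Prod.snd_swap] at hp ⊢; linarith)
    have := log_sub_log_const (c := 1) (a := l) (b := fun p ↦ l p.swap) hconv.isPreconnected
      (lc.mono im_pos)
      (lc.comp continuous_swap.continuousOn hsw)
      (fun p hp ↦ by rw [le p (im_pos p hp), le _ (hsw p hp), hRs, one_mul]) hp
      (show (x₀, y₀) ∈ _ by simp [x₀, y₀])
    simp only [Prod.swap_prod_mk, hbase, sub_self] at this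
    exact sub_eq_zero.1 this
  have hboth : ∀ p ∈ A, p.swap ∈ A → l p = l p.swap := by
    intro p hp hp'
    rcases lt_trichotomy (p.1 - p.2).im 0 with h | h | h
    · have := hup p.swap (by
        simp only [Complex.sub_im, Prod.fst_swap, Prod.snd_swap] at h ⊢; linarith)
      rw [Prod.swap_swap] at this
      exact this.symm
    · have h' : (p.2 - p.1).im = 0 := by simp only [Complex.sub_im] at h ⊢; linarith
      have h1 := hp.resolve_right (not_not.2 h)
      have h2 : 0 < (p.2 - p.1).re := Or.resolve_right hp' (not_not.2 h')
      simp only [Complex.sub_re] at h1 h2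
      linarith
    · exact hup p h
  have hcover : ∀ p : ℂ × ℂ, p.1 ≠ p.2 → p ∉ A → p.swap ∈ A := by
    intro p hp hpA
    have h1 : p.1 - p.2 ∉ Complex.slitPlane := hpA
    rw [Complex.mem_slitPlane_iff, not_or, not_lt, not_not] at h1
    refine Or.inl ?_
    simp only [Complex.sub_re, Complex.sub_im, Prod.fst_swap, Prod.snd_swap] at h1 ⊢
    rcases h1.1.lt_or_eq with h | h
    · linarith
    · exact absurd (Complex.ext (by linarith) (by linarith)) hp
  classical
  let m : ℂ × ℂ → ℂ := fun p ↦ if p ∈ A then l p else l p.swap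
  have hm1 : ∀ p ∈ A, m p = l p := fun p hp ↦ if_pos hp
  have hm2 : ∀ p : ℂ × ℂ, p.swap ∈ A → m p = l p.swap := by
    intro p hp
    by_cases h : p ∈ A
    · rw [hm1 p h, hboth p h hp]
    · exact if_neg h
  have hmswap : ∀ p : ℂ × ℂ, p.1 ≠ p.2 → m p = m p.swap := by
    intro p hp
    by_cases h : p ∈ A
    · rw [hm1 p h, hm2 p.swap (by rwa [Prod.swap_swap]), Prod.swap_swap]
    · rw [hm2 p (hcover p hp h), hm1 _ (hcover p hp h)]
  refine ⟨m, fun p hp ↦ ContinuousAt.continuousWithinAt ?_, fun p hp ↦ ?_, fun x y hxy ↦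
    hmswap (x, y) hxy⟩
  · by_cases h : p ∈ A
    · exact ((lc.continuousAt (hAo.mem_nhds h))).congr
        (Filter.eventuallyEq_of_mem (hAo.mem_nhds h) fun q hq ↦ (hm1 q hq).symm)
    · have h' := hcover p hp h
      have ho : IsOpen (Prod.swap ⁻¹' A) := hAo.preimage continuous_swap
      refine ContinuousAt.congr (f := fun q ↦ l q.swap) ?_
        (Filter.eventuallyEq_of_mem (ho.mem_nhds h') fun q hq ↦ (hm2 q hq).symm)
      exact ContinuousAt.comp (g := l) (lc.continuousAt (hAo.mem_nhds h'))
        continuous_swap.continuousAt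
  · have hx := sub_ne_zero.2 hp
    have : Complex.exp (m p) = R p := by
      by_cases h : p ∈ A
      · rw [hm1 p h, le p h]
      · rw [hm2 p (hcover p hp h), le _ (hcover p hp h), hRs]
    rw [this]
    exact div_mul_cancel₀ _ hx

/-- A closed walk contains a closed walk through pairwise distinct vertices. -/
theorem exists_cycle_of_transGen {T : Type*} {E : T → T → Prop} {a : T}
    (h : Relation.TransGen E a a) :
    ∃ n : ℕ, n ≠ 0 ∧ ∃ d : ℕ → T, (∀ i < n, ∀ j < n, i ≠ j → d i ≠ d j) ∧
      ∀ i < n, E (d i) (d ((i + 1) % n)) := by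
  classical
  have hwalk : ∀ b, Relation.TransGen E a b → ∃ n : ℕ, n ≠ 0 ∧ ∃ d : ℕ → T,
      d 0 = a ∧ d n = b ∧ ∀ i < n, E (d i) (d (i + 1)) := by
    intro b hb
    induction hb with
    | @single c hc =>
      refine ⟨1, one_ne_zero, fun i ↦ if i = 0 then a else c, by simp, by simp, fun i hi ↦ ?_⟩
      obtain rfl : i = 0 := by omega
      simpa using hc
    | @tail c e _ hce ih =>
      obtain ⟨n, hn, d, h0, h1, hd⟩ := ih
      refine ⟨n + 1, by omega, fun i ↦ if i ≤ n then d i else e, by simpa using h0, by simp,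
        fun i hi ↦ ?_⟩
      rcases Nat.lt_succ_iff_lt_or_eq.1 hi with hi | rfl
      · simpa [hi.le, Nat.succ_le_of_lt hi] using hd i hi
      · simpa [h1] using hce
  have hex : ∃ n : ℕ, n ≠ 0 ∧ ∃ d : ℕ → T, ∀ i < n, E (d i) (d ((i + 1) % n)) := by
    obtain ⟨n, hn, d, h0, h1, hd⟩ := hwalk a h
    refine ⟨n, hn, d, fun i hi ↦ ?_⟩
    rcases eq_or_ne (i + 1) n with he | he
    · have := hd i hi
      rw [he, h1, ← h0] at this
      rw [he, Nat.mod_self]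
      exact this
    · rw [Nat.mod_eq_of_lt (by omega)]
      exact hd i hi
  obtain ⟨hn, d, hd⟩ := Nat.find_spec hex
  refine ⟨Nat.find hex, hn, d, ?_, hd⟩
  have key : ∀ i < Nat.find hex, ∀ j < Nat.find hex, i < j → d i ≠ d j := by
    intro i hi j hj hij he
    refine Nat.find_min hex (m := j - i) (by omega) ⟨by omega, fun k ↦ d (i + k), fun k hk ↦ ?_⟩
    have h1 := hd (i + k) (by omega)
    rw [Nat.mod_eq_of_lt (by omega)] at h1
    rcases eq_or_ne (k + 1) (j - i) with hk' | hk'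
    · simp only [hk', Nat.mod_self, add_zero, he]
      rwa [show i + k + 1 = j by omega] at h1
    · rwa [Nat.mod_eq_of_lt (by omega)]
  intro i hi j hj hij
  rcases lt_or_gt_of_ne hij with hlt | hlt
  · exact key i hi j hj hlt
  · exact (key j hj i hi hlt).symm

section ShiftInvariant

variable {T : Type*} {E : T → T → Prop} {σ : Equiv.Perm T}

theorem reflTransGen_zpow (hE : ∀ a b, E a b ↔ E (σ a) (σ b)) {a b : T}
    (h : Relation.ReflTransGen E a b) (k : ℤ) :
    Relation.ReflTransGen E ((σ ^ k) a) ((σ ^ k) b) := by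
  have hk : ∀ a b, E a b ↔ E ((σ ^ k) a) ((σ ^ k) b) := by
    induction k with
    | zero => simp
    | succ n ih => intro a b; rw [add_comm, zpow_add, zpow_one]; exact (ih a b).trans (hE _ _)
    | pred n ih =>
      intro a b
      rw [sub_eq_neg_add, zpow_add, ih a b, hE (((σ ^ (-1 : ℤ)) * σ ^ (-n : ℤ)) a)]
      simp
  exact h.lift _ fun a b ↦ (hk a b).1

theorem reflTransGen_zpow_trans (hE : ∀ a b, E a b ↔ E (σ a) (σ b)) {a b c : T} {k l : ℤ}
    (h : Relation.ReflTransGen E a ((σ ^ k) b)) (h' : Relation.ReflTransGen E b ((σ ^ l) c)) :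
    Relation.ReflTransGen E a ((σ ^ (k + l)) c) := by
  rw [zpow_add]
  exact h.trans (reflTransGen_zpow hE h' k)

theorem reflTransGen_zpow_mul (hE : ∀ a b, E a b ↔ E (σ a) (σ b)) {a : T} {k : ℤ}
    (h : Relation.ReflTransGen E a ((σ ^ k) a)) (n : ℕ) :
    Relation.ReflTransGen E a ((σ ^ (n * k)) a) := by
  induction n with
  | zero => simpa using Relation.ReflTransGen.refl
  | succ n ih =>
    have := reflTransGen_zpow_trans hE ih h
    rwa [show (n : ℤ) * k + k = ((n + 1 : ℕ) : ℤ) * k by push_cast; ring] at this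

/-- A shift-invariant relation which is strongly connected modulo the shift, has finitely many
orbits of vertices, and has walks with arbitrarily negative and arbitrarily positive drift
has a closed walk. -/
theorem exists_transGen_self_of_drift (hE : ∀ a b, E a b ↔ E (σ a) (σ b))
    (hσ : ∀ a, ∀ k : ℤ, (σ ^ k) a = a → k = 0) {X : Set T} (hX : X.Finite)
    (hconn : ∀ a b, ∃ k : ℤ, Relation.ReflTransGen E a ((σ ^ k) b))
    (hneg : ∀ K : ℤ, ∃ a ∈ X, ∃ b ∈ X, ∃ k < K, Relation.ReflTransGen E a ((σ ^ k) b))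
    (hpos : ∀ K : ℤ, ∃ a ∈ X, ∃ b ∈ X, ∃ k > K, Relation.ReflTransGen E a ((σ ^ k) b)) :
    ∃ a, Relation.TransGen E a a := by
  choose κ hκ using hconn
  obtain ⟨K, hK⟩ : ∃ K : ℤ, ∀ a ∈ X, ∀ b ∈ X, |κ a b| ≤ K := by
    obtain ⟨K, hK⟩ := ((hX.prod hX).image fun p : T × T ↦ |κ p.1 p.2|).bddAbove
    exact ⟨K, fun a ha b hb ↦ hK ⟨(a, b), ⟨ha, hb⟩, rfl⟩⟩
  obtain ⟨a, ha, b, hb, k, hk, hab⟩ := hneg (-K)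
  obtain ⟨a', ha', b', hb', k', hk', hab'⟩ := hpos K
  have h1 := reflTransGen_zpow_trans hE hab (hκ b a)
  have h2 := reflTransGen_zpow_trans hE hab' (hκ b' a')
  have hm : k + κ b a < 0 := by linarith [(abs_le.1 (hK b hb a ha)).2]
  have hm' : 0 < k' + κ b' a' := by linarith [(abs_le.1 (hK b' hb' a' ha')).1]
  set m := k + κ b a
  set m' := k' + κ b' a'
  set p : ℕ := (|κ a a' + κ a' a| + 1).toNat
  have hp : (p : ℤ) = |κ a a' + κ a' a| + 1 := Int.toNat_of_nonneg (by positivity)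
  have h3 := reflTransGen_zpow_trans hE (reflTransGen_zpow_trans hE (hκ a a')
    (reflTransGen_zpow_mul hE h2 p)) (hκ a' a)
  have hM : 0 < κ a a' + p * m' + κ a' a := by
    have := neg_abs_le (κ a a' + κ a' a)
    nlinarith [abs_nonneg (κ a a' + κ a' a)]
  set M := κ a a' + p * m' + κ a' a
  have h4 := reflTransGen_zpow_mul hE h1 M.toNat
  have h5 := reflTransGen_zpow_mul hE h3 (-m).toNat
  rw [Int.toNat_of_nonneg hM.le] at h4
  rw [Int.toNat_of_nonneg (by omega)] at h5
  refine ⟨a, ?_⟩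
  rcases Relation.reflTransGen_iff_eq_or_transGen.1 h4 with h6 | h6
  · have := hσ _ _ h6
    rcases mul_eq_zero.1 this with h | h <;> omega
  · have h7 := h6.trans_left (reflTransGen_zpow hE h5 (M * m))
    rwa [← Equiv.Perm.mul_apply, ← zpow_add, show M * m + -m * M = 0 by ring, zpow_zero,
      Equiv.Perm.one_apply] at h7

end ShiftInvariant

theorem exists_birkhoff_prob {X : Type*} [MeasurableSpace X] (f : X → X) {n : ℕ} (hn : n ≠ 0)
    (x : X) : ∃ μ : ProbabilityMeasure X, ∀ φ : X → ℝ, StronglyMeasurable φ →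
      ∫ y, φ y ∂(μ : Measure X) = (n : ℝ)⁻¹ * birkhoffSum f φ n x := by
  let ν : Measure X := (n : ENNReal)⁻¹ • ∑ i ∈ Finset.range n, Measure.dirac (f^[i] x)
  have hν : IsProbabilityMeasure ν := by
    constructor
    simp only [ν, Measure.smul_apply, Measure.finsetSum_apply, measure_univ, Finset.sum_const,
      Finset.card_range, nsmul_eq_mul, mul_one, smul_eq_mul]
    exact ENNReal.inv_mul_cancel (by exact_mod_cast hn) (ENNReal.natCast_ne_top n)
  refine ⟨⟨ν, hν⟩, fun φ hφ ↦ ?_⟩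
  have hi : ∀ i ∈ Finset.range n, Integrable φ (Measure.dirac (f^[i] x)) := fun i _ ↦
    integrable_dirac' hφ (by simp)
  simp only [ProbabilityMeasure.coe_mk, ν]
  rw [integral_smul_measure, integral_finsetSum_measure hi]
  simp only [integral_dirac' _ _ hφ, ENNReal.toReal_inv, ENNReal.toReal_natCast, smul_eq_mul,
    birkhoffSum]

/-- If all invariant probability measures give the same integral to a continuous function, then
its Birkhoff averages converge uniformly to this integral. -/
theorem exists_birkhoffSum_bound {X : Type*} [TopologicalSpace X] [CompactSpace X] [T2Space X]
    [HasOuterApproxClosed X] [MeasurableSpace X] [BorelSpace X] {f : X → X} (hf : Continuous f)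
    {F : X → ℝ} (hF : Continuous F) {α : ℝ}
    (hα : ∀ μ : Measure X, IsProbabilityMeasure μ → MeasurePreserving f μ μ → ∫ x, F x ∂μ = α)
    {ε : ℝ} (hε : 0 < ε) :
    ∃ C : ℝ, ∀ (n : ℕ) (x : X), |birkhoffSum f F n x - n * α| ≤ ε * n + C := by
  have hbdd : ∀ φ : X → ℝ, Continuous φ → ∃ B : ℝ, ∀ x, |φ x| ≤ B := by
    intro φ hφ
    obtain ⟨B, hB⟩ := isCompact_univ.exists_bound_of_continuousOn hφ.continuousOn
    exact ⟨B, fun x ↦ hB x (mem_univ x)⟩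
  by_contra! hcon
  choose n x hnx using fun k : ℕ ↦ hcon k
  obtain ⟨B, hB⟩ := hbdd F hF
  have hle : ∀ (n : ℕ) (x : X), |birkhoffSum f F n x - n * α| ≤ n * (B + |α|) := by
    intro n x
    refine (abs_sub _ _).trans ?_
    have h1 : |birkhoffSum f F n x| ≤ n * B := by
      refine (Finset.abs_sum_le_sum_abs _ _).trans ?_
      simpa using Finset.sum_le_sum fun i (_ : i ∈ Finset.range n) ↦ hB (f^[i] x)
    rw [abs_mul, Nat.abs_cast]
    linarith
  have hn0 : ∀ k, n k ≠ 0 := by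
    intro k hk
    have := hnx k
    rw [hk] at this
    simp only [birkhoffSum_zero, Nat.cast_zero, zero_mul, sub_zero, abs_zero, mul_zero,
      zero_add] at this
    linarith [Nat.cast_nonneg (α := ℝ) k]
  have hntop : Filter.Tendsto (fun k ↦ (n k : ℝ)⁻¹) Filter.atTop (nhds 0) := by
    refine tendsto_inv_atTop_zero.comp ?_
    have hB0 : 0 < B + |α| + 1 := by
      have := (abs_nonneg _).trans (hB (x 0))
      positivity
    refine Filter.tendsto_atTop_mono (fun k ↦ ?_)
      (tendsto_natCast_atTop_atTop.atTop_div_const hB0)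
    rw [div_le_iff₀ hB0]
    nlinarith [hnx k, hle (n k) (x k), Nat.cast_nonneg (α := ℝ) (n k),
      mul_nonneg hε.le (Nat.cast_nonneg (α := ℝ) (n k))]
  choose ν hν using fun k ↦ exists_birkhoff_prob f (hn0 k) (x k)
  obtain ⟨μ, hμ⟩ : ∃ μ, Filter.Tendsto ν (Filter.hyperfilter ℕ) (nhds μ) :=
    ⟨_, ((Filter.hyperfilter ℕ).map ν).le_nhds_lim⟩
  have hntop' : Filter.Tendsto (fun k ↦ (n k : ℝ)⁻¹) (Filter.hyperfilter ℕ) (nhds 0) :=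
    hntop.mono_left Nat.hyperfilter_le_atTop
  rw [ProbabilityMeasure.tendsto_iff_forall_integral_tendsto] at hμ
  have hlim : ∀ φ : X → ℝ, Continuous φ → Filter.Tendsto
      (fun k ↦ (n k : ℝ)⁻¹ * birkhoffSum f φ (n k) (x k)) (Filter.hyperfilter ℕ)
      (nhds (∫ y, φ y ∂(μ : Measure X))) := by
    intro φ hφ
    refine (hμ (BoundedContinuousFunction.mkOfCompact ⟨φ, hφ⟩)).congr fun k ↦ ?_
    exact hν k φ hφ.stronglyMeasurable
  have hinv : MeasurePreserving f (μ : Measure X) (μ : Measure X) := by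
    refine ⟨hf.measurable, ?_⟩
    have := Measure.isProbabilityMeasure_map (μ := (μ : Measure X)) hf.aemeasurable
    refine ext_of_forall_integral_eq_of_IsFiniteMeasure fun φ ↦ ?_
    rw [integral_map hf.aemeasurable φ.continuous.aestronglyMeasurable]
    have h1 := (hlim _ (φ.continuous.comp hf)).sub (hlim φ φ.continuous)
    have h2 : Filter.Tendsto (fun k ↦ (n k : ℝ)⁻¹ * birkhoffSum f (φ ∘ f) (n k) (x k) -
        (n k : ℝ)⁻¹ * birkhoffSum f φ (n k) (x k)) (Filter.hyperfilter ℕ) (nhds 0) := by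
      have h3 : ∀ k, (n k : ℝ)⁻¹ * birkhoffSum f (φ ∘ f) (n k) (x k) -
          (n k : ℝ)⁻¹ * birkhoffSum f φ (n k) (x k)
          = (n k : ℝ)⁻¹ * (φ (f^[n k] (x k)) - φ (x k)) := by
        intro k
        rw [← birkhoffSum_apply_sub_birkhoffSum, ← mul_sub]
        congr 2
        exact Finset.sum_congr rfl fun i _ ↦ by
          rw [Function.comp_apply, ← Function.iterate_succ_apply' f, Function.iterate_succ_apply]
      simp_rw [h3]
      refine squeeze_zero_norm (a := fun k ↦ (n k : ℝ)⁻¹ * (‖φ‖ + ‖φ‖)) (fun k ↦ ?_)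
        (by simpa using hntop'.mul_const (‖φ‖ + ‖φ‖))
      rw [norm_mul, norm_inv, Real.norm_natCast]
      gcongr
      exact (norm_sub_le _ _).trans (add_le_add (φ.norm_coe_le_norm _) (φ.norm_coe_le_norm _))
    exact sub_eq_zero.1 (tendsto_nhds_unique h1 h2)
  have h4 := (hlim F hF)
  rw [hα μ inferInstance hinv] at h4
  have h5 : ∀ k, ε ≤ |(n k : ℝ)⁻¹ * birkhoffSum f F (n k) (x k) - α| := by
    intro k
    have hpos : (0 : ℝ) < n k := by exact_mod_cast Nat.pos_of_ne_zero (hn0 k)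
    rw [show (n k : ℝ)⁻¹ * birkhoffSum f F (n k) (x k) - α =
      (birkhoffSum f F (n k) (x k) - n k * α) / n k by field_simp, abs_div, Nat.abs_cast,
      le_div_iff₀ hpos]
    linarith [hnx k, Nat.cast_nonneg (α := ℝ) k]
  have h6 := ge_of_tendsto' (h4.sub_const α).abs h5
  rw [sub_self, abs_zero] at h6
  linarith

/-- Homeomorphisms of the strip which commute with the deck transformation and preserve each of
the two boundary lines. -/
structure IsStripMap (gt : AnnulusCover ≃ₜ AnnulusCover) : Prop where
  shift : ∀ z : AnnulusCover, gt (z.1 + 1, z.2) = ((gt z).1 + 1, (gt z).2)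
  top : ∀ z : AnnulusCover, ((gt z).2 : ℝ) = 1 ↔ (z.2 : ℝ) = 1
  bot : ∀ z : AnnulusCover, ((gt z).2 : ℝ) = -1 ↔ (z.2 : ℝ) = -1

theorem shift_int {gt : AnnulusCover → AnnulusCover}
    (h : ∀ z : AnnulusCover, gt (z.1 + 1, z.2) = ((gt z).1 + 1, (gt z).2)) (n : ℤ)
    (z : AnnulusCover) : gt (z.1 + n, z.2) = ((gt z).1 + n, (gt z).2) := by
  induction n using Int.induction_on with
  | zero => simp
  | succ i ih =>
    have := h (z.1 + i, z.2)
    push_cast at ih ⊢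
    rw [← add_assoc, this, ih, add_assoc]
  | pred i ih =>
    have := h (z.1 + (-i - 1 : ℤ), z.2)
    push_cast at ih this ⊢
    rw [show z.1 + (-(i : ℝ) - 1) + 1 = z.1 + -i by ring, ih] at this
    refine Prod.ext ?_ ?_
    · have := congrArg Prod.fst this
      simp only at this ⊢
      linarith
    · exact (congrArg Prod.snd this).symm

/-- A continuous `1`-periodic function on the strip takes its values on a fundamental domain. -/
theorem exists_bound_of_periodic {F : AnnulusCover → ℝ} (hc : Continuous F)
    (hp : ∀ (z : AnnulusCover) (n : ℤ), F (z.1 + n, z.2) = F z) :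
    ∃ z₀ z₁, ∀ z, F z₀ ≤ F z ∧ F z ≤ F z₁ := by
  have hK : IsCompact (Icc (0 : ℝ) 1 ×ˢ (univ : Set (Icc (-1 : ℝ) 1))) :=
    isCompact_Icc.prod isCompact_univ
  have hne : (Icc (0 : ℝ) 1 ×ˢ (univ : Set (Icc (-1 : ℝ) 1))).Nonempty :=
    ⟨(0, ⟨0, by norm_num⟩), ⟨by norm_num, mem_univ _⟩⟩
  obtain ⟨z₀, -, h0⟩ := hK.exists_isMinOn hne hc.continuousOn
  obtain ⟨z₁, -, h1⟩ := hK.exists_isMaxOn hne hc.continuousOn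
  refine ⟨z₀, z₁, fun z ↦ ?_⟩
  have e := hp (Int.fract z.1, z.2) ⌊z.1⌋
  simp only [Int.fract_add_floor] at e
  have hm : (Int.fract z.1, z.2) ∈ Icc (0 : ℝ) 1 ×ˢ (univ : Set (Icc (-1 : ℝ) 1)) :=
    ⟨⟨Int.fract_nonneg _, (Int.fract_lt_one _).le⟩, mem_univ _⟩
  rw [show F z = F (z.1, z.2) from rfl, e]
  exact ⟨h0 hm, h1 hm⟩

theorem IsStripMap.exists_bound {gt : AnnulusCover ≃ₜ AnnulusCover}
    (h : ∀ z : AnnulusCover, gt (z.1 + 1, z.2) = ((gt z).1 + 1, (gt z).2)) :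
    ∃ M, ∀ z, |(gt z).1 - z.1| ≤ M := by
  obtain ⟨z₀, z₁, hz⟩ := exists_bound_of_periodic (F := fun z ↦ |(gt z).1 - z.1|) (by fun_prop)
    (fun z n ↦ by rw [shift_int h]; simp)
  exact ⟨_, fun z ↦ (hz z).2⟩

/-- The nearest point retraction of the plane onto the strip. -/
def stripPt (z : ℂ) : AnnulusCover := (z.re, projIcc (-1) 1 (by norm_num) z.im)

/-- The inclusion of the strip in the plane. -/
def stripEmb (z : AnnulusCover) : ℂ := ⟨z.1, z.2⟩

theorem continuous_stripPt : Continuous stripPt :=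
  Complex.continuous_re.prodMk (continuous_projIcc.comp Complex.continuous_im)

theorem continuous_stripEmb : Continuous stripEmb :=
  Complex.equivRealProdCLM.symm.continuous.comp
    (continuous_fst.prodMk (continuous_subtype_val.comp continuous_snd))

theorem stripPt_stripEmb (z : AnnulusCover) : stripPt (stripEmb z) = z := by
  simp [stripPt, stripEmb, projIcc_val]

theorem stripEmb_stripPt {z : ℂ} (hz : z.im ∈ Icc (-1 : ℝ) 1) : stripEmb (stripPt z) = z := by
  apply Complex.ext <;> simp [stripPt, stripEmb, projIcc_of_mem _ hz]

theorem stripEmb_injective : Function.Injective stripEmb :=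
  Function.LeftInverse.injective stripPt_stripEmb

/-- Extension of a map of the strip to the plane, interpolating to translations outside of the
collars of width `η` of the strip. -/
def stripExtend (gt : AnnulusCover → AnnulusCover) (η s₁ s₂ : ℝ) (z : ℂ) : ℂ :=
  ⟨(gt (stripPt z)).1 + max 0 (min 1 ((z.im - 1) / η)) * (z.re + s₁ - (gt (stripPt z)).1)
    + max 0 (min 1 ((-1 - z.im) / η)) * (z.re + s₂ - (gt (stripPt z)).1),
    (gt (stripPt z)).2 + (z.im - (stripPt z).2)⟩

theorem continuous_stripExtend {gt : AnnulusCover → AnnulusCover} (hg : Continuous gt)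
    (η s₁ s₂ : ℝ) : Continuous (stripExtend gt η s₁ s₂) := by
  have hw := hg.comp continuous_stripPt
  have h2 : Continuous fun z ↦ ((stripPt z).2 : ℝ) :=
    continuous_subtype_val.comp (continuous_snd.comp continuous_stripPt)
  have h3 : Continuous fun z ↦ ((gt (stripPt z)).2 : ℝ) :=
    continuous_subtype_val.comp (continuous_snd.comp hw)
  have h1 : Continuous fun z ↦ (gt (stripPt z)).1 := continuous_fst.comp hw
  exact Complex.equivRealProdCLM.symm.continuous.comp (Continuous.prodMk (by fun_prop) (by fun_prop))

theorem stripExtend_of_mem {gt : AnnulusCover → AnnulusCover} {η s₁ s₂ : ℝ} (hη : 0 < η) {z : ℂ}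
    (hz : z.im ∈ Icc (-1 : ℝ) 1) : stripExtend gt η s₁ s₂ z = stripEmb (gt (stripPt z)) := by
  have e1 : max 0 (min 1 ((z.im - 1) / η)) = 0 :=
    max_eq_left ((min_le_right _ _).trans (div_nonpos_of_nonpos_of_nonneg (by linarith [hz.2]) hη.le))
  have e2 : max 0 (min 1 ((-1 - z.im) / η)) = 0 :=
    max_eq_left ((min_le_right _ _).trans (div_nonpos_of_nonpos_of_nonneg (by linarith [hz.1]) hη.le))
  rw [stripExtend, e1, e2]
  apply Complex.ext <;> simp [stripEmb, stripPt, projIcc_of_mem _ hz]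

theorem stripExtend_stripEmb {gt : AnnulusCover → AnnulusCover} {η s₁ s₂ : ℝ} (hη : 0 < η)
    (z : AnnulusCover) : stripExtend gt η s₁ s₂ (stripEmb z) = stripEmb (gt z) := by
  rw [stripExtend_of_mem hη z.2.2, stripPt_stripEmb]

/-- The interpolation parameter of the collars. -/
def collarParam (η t : ℝ) : ℝ := max 0 (min 1 (t / η))

theorem collarParam_mem (η t : ℝ) : collarParam η t ∈ Icc (0 : ℝ) 1 :=
  ⟨le_max_left _ _, max_le zero_le_one (min_le_left _ _)⟩

theorem collarParam_eq_one {η t : ℝ} (hη : 0 < η) (h : η ≤ t) : collarParam η t = 1 := by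
  rw [collarParam, min_eq_left ((one_le_div hη).2 h), max_eq_right zero_le_one]

theorem stripExtend_of_le {gt : AnnulusCover ≃ₜ AnnulusCover} (hg : IsStripMap gt)
    {η s₁ s₂ : ℝ} (hη : 0 < η) {z : ℂ} (hz : 1 ≤ z.im) :
    stripExtend gt η s₁ s₂ z = ⟨(1 - collarParam η (z.im - 1)) * (gt (z.re, ⟨1, by norm_num⟩)).1
      + collarParam η (z.im - 1) * (z.re + s₁), z.im⟩ := by
  have e : stripPt z = (z.re, ⟨1, by norm_num⟩) := by
    rw [stripPt, projIcc_of_right_le _ hz]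
  have e2 : max 0 (min 1 ((-1 - z.im) / η)) = 0 :=
    max_eq_left ((min_le_right _ _).trans (div_nonpos_of_nonpos_of_nonneg (by linarith) hη.le))
  rw [stripExtend, e2, e]
  have := (hg.top (z.re, ⟨1, by norm_num⟩)).2 rfl
  apply Complex.ext
  · simp only [collarParam]; ring
  · simp [this]

theorem stripExtend_of_ge {gt : AnnulusCover ≃ₜ AnnulusCover} (hg : IsStripMap gt)
    {η s₁ s₂ : ℝ} (hη : 0 < η) {z : ℂ} (hz : z.im ≤ -1) :
    stripExtend gt η s₁ s₂ z = ⟨(1 - collarParam η (-1 - z.im)) * (gt (z.re, ⟨-1, by norm_num⟩)).1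
      + collarParam η (-1 - z.im) * (z.re + s₂), z.im⟩ := by
  have e : stripPt z = (z.re, ⟨-1, by norm_num⟩) := by
    rw [stripPt, projIcc_of_le_left _ hz]
  have e2 : max 0 (min 1 ((z.im - 1) / η)) = 0 :=
    max_eq_left ((min_le_right _ _).trans (div_nonpos_of_nonpos_of_nonneg (by linarith) hη.le))
  rw [stripExtend, e2, e]
  have := (hg.bot (z.re, ⟨-1, by norm_num⟩)).2 rfl
  apply Complex.ext
  · simp only [collarParam]; ring
  · simp [this]

theorem strictMono_of_shift {a : ℝ → ℝ} (hc : Continuous a) (hi : Function.Injective a)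
    (hs : ∀ x, a (x + 1) = a x + 1) : StrictMono a := by
  refine (hc.strictMono_of_inj hi).resolve_right fun h ↦ ?_
  have := h (lt_add_one (0 : ℝ))
  rw [hs] at this
  linarith

theorem IsStripMap.strictMono_top {gt : AnnulusCover ≃ₜ AnnulusCover} (hg : IsStripMap gt) :
    StrictMono fun x : ℝ ↦ (gt (x, ⟨1, by norm_num⟩)).1 := by
  refine strictMono_of_shift (by fun_prop) (fun x y hxy ↦ ?_) fun x ↦ by
    rw [hg.shift (x, ⟨1, by norm_num⟩)]
  have h1 := (hg.top (x, ⟨1, by norm_num⟩)).2 rfl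
  have h2 := (hg.top (y, ⟨1, by norm_num⟩)).2 rfl
  exact congrArg Prod.fst (gt.injective (Prod.ext hxy (Subtype.ext (h1.trans h2.symm))))

theorem IsStripMap.strictMono_bot {gt : AnnulusCover ≃ₜ AnnulusCover} (hg : IsStripMap gt) :
    StrictMono fun x : ℝ ↦ (gt (x, ⟨-1, by norm_num⟩)).1 := by
  refine strictMono_of_shift (by fun_prop) (fun x y hxy ↦ ?_) fun x ↦ by
    rw [hg.shift (x, ⟨-1, by norm_num⟩)]
  have h1 := (hg.bot (x, ⟨-1, by norm_num⟩)).2 rfl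
  have h2 := (hg.bot (y, ⟨-1, by norm_num⟩)).2 rfl
  exact congrArg Prod.fst (gt.injective (Prod.ext hxy (Subtype.ext (h1.trans h2.symm))))

theorem bijective_interpolate {a : ℝ → ℝ} (hc : Continuous a) (ha : StrictMono a) {M : ℝ}
    (hM : ∀ x, |a x - x| ≤ M) (s : ℝ) {t : ℝ} (ht : t ∈ Icc (0 : ℝ) 1) :
    Function.Bijective fun x ↦ (1 - t) * a x + t * (x + s) := by
  have hb : ∀ x, |(1 - t) * a x + t * (x + s) - x| ≤ M + |s| := by
    intro x
    have e : (1 - t) * a x + t * (x + s) - x = (1 - t) * (a x - x) + t * s := by ring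
    rw [e]
    refine (abs_add_le _ _).trans (add_le_add ?_ ?_)
    · rw [abs_mul, abs_of_nonneg (by linarith [ht.2])]
      nlinarith [hM x, abs_nonneg (a x - x), ht.1, ht.2]
    · rw [abs_mul, abs_of_nonneg ht.1]
      exact mul_le_of_le_one_left (abs_nonneg _) ht.2
  refine ⟨StrictMono.injective fun x y hxy ↦ ?_, Continuous.surjective (by fun_prop) ?_ ?_⟩
  · have := ha hxy
    rcases ht.2.eq_or_lt with rfl | h1
    · linarith
    · nlinarith [ht.1]
  · refine Filter.tendsto_atTop_mono (f := fun x ↦ x - (M + |s|)) (fun x ↦ ?_)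
      (Filter.tendsto_atTop_add_const_right _ _ Filter.tendsto_id)
    linarith [(abs_le.1 (hb x)).1]
  · refine Filter.tendsto_atBot_mono (f := fun x ↦ x + (M + |s|)) (fun x ↦ ?_)
      (Filter.tendsto_atBot_add_const_right _ _ Filter.tendsto_id)
    linarith [(abs_le.1 (hb x)).2]

theorem isHomeomorph_of_bounded_displacement {H : ℂ → ℂ} (hc : Continuous H)
    (hb : Function.Bijective H) {M : ℝ} (hM : ∀ z, ‖H z - z‖ ≤ M) :
    ∃ h : ℂ ≃ₜ ℂ, ∀ z, h z = H z := by
  have hp : IsProperMap H := by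
    refine isProperMap_iff_tendsto_cocompact.2 ⟨hc, ?_⟩
    rw [← Metric.cobounded_eq_cocompact, ← tendsto_norm_atTop_iff_cobounded]
    refine Filter.tendsto_atTop_mono (f := fun z ↦ ‖z‖ - M) (fun z ↦ ?_)
      (Filter.tendsto_atTop_add_const_right _ _ tendsto_norm_cobounded_atTop)
    have := norm_sub_norm_le z (H z)
    rw [norm_sub_rev] at this
    linarith [hM z]
  exact ⟨(Equiv.ofBijective H hb).toHomeomorphOfContinuousClosed hc hp.isClosedMap, fun z ↦ rfl⟩

theorem stripExtend_im_mem {gt : AnnulusCover ≃ₜ AnnulusCover} (hg : IsStripMap gt) {η : ℝ}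
    (hη : 0 < η) (s₁ s₂ : ℝ) {z : ℂ} :
    (stripExtend gt η s₁ s₂ z).im ∈ Icc (-1 : ℝ) 1 ↔ z.im ∈ Icc (-1 : ℝ) 1 := by
  constructor
  · intro h
    by_contra hz
    rcases lt_or_ge 1 z.im with h1 | h1
    · rw [stripExtend_of_le hg hη h1.le] at h
      exact hz h
    · have h2 : z.im < -1 := by
        by_contra h2
        exact hz ⟨not_lt.1 h2, h1⟩
      rw [stripExtend_of_ge hg hη h2.le] at h
      exact hz h
  · intro h
    rw [stripExtend_of_mem hη h]
    exact (gt (stripPt z)).2.2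

theorem stripExtend_im_of_notMem {gt : AnnulusCover ≃ₜ AnnulusCover} (hg : IsStripMap gt) {η : ℝ}
    (hη : 0 < η) (s₁ s₂ : ℝ) {z : ℂ} (hz : z.im ∉ Icc (-1 : ℝ) 1) :
    (stripExtend gt η s₁ s₂ z).im = z.im := by
  rcases lt_or_ge 1 z.im with h1 | h1
  · rw [stripExtend_of_le hg hη h1.le]
  · rw [stripExtend_of_ge hg hη (not_lt.1 fun h2 ↦ hz ⟨h2.le, h1⟩)]

theorem bijective_stripExtend {gt : AnnulusCover ≃ₜ AnnulusCover} (hg : IsStripMap gt) {η : ℝ}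
    (hη : 0 < η) (s₁ s₂ : ℝ) : Function.Bijective (stripExtend gt η s₁ s₂) := by
  obtain ⟨M, hM⟩ := IsStripMap.exists_bound hg.shift
  have htop := fun t ↦ bijective_interpolate (t := t) (by fun_prop) hg.strictMono_top
    (fun x ↦ hM (x, ⟨1, by norm_num⟩)) s₁
  have hbot := fun t ↦ bijective_interpolate (t := t) (by fun_prop) hg.strictMono_bot
    (fun x ↦ hM (x, ⟨-1, by norm_num⟩)) s₂
  constructor
  · intro z w hzw
    by_cases hz : z.im ∈ Icc (-1 : ℝ) 1
    · have hw : w.im ∈ Icc (-1 : ℝ) 1 := by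
        rwa [← stripExtend_im_mem hg hη s₁ s₂, ← hzw, stripExtend_im_mem hg hη]
      rw [stripExtend_of_mem hη hz, stripExtend_of_mem hη hw] at hzw
      rw [← stripEmb_stripPt hz, gt.injective (stripEmb_injective hzw), stripEmb_stripPt hw]
    · have hw : w.im ∉ Icc (-1 : ℝ) 1 := by
        rwa [← stripExtend_im_mem hg hη s₁ s₂, ← hzw, stripExtend_im_mem hg hη]
      have him : z.im = w.im := by
        rw [← stripExtend_im_of_notMem hg hη s₁ s₂ hz, hzw, stripExtend_im_of_notMem hg hη _ _ hw]
      refine Complex.ext ?_ him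
      rcases lt_or_ge 1 z.im with h1 | h1
      · rw [stripExtend_of_le hg hη h1.le, stripExtend_of_le hg hη (him ▸ h1.le), ← him] at hzw
        exact (htop _ (collarParam_mem η _)).1 (congrArg Complex.re hzw)
      · have h2 : z.im ≤ -1 := not_lt.1 fun h2 ↦ hz ⟨h2.le, h1⟩
        rw [stripExtend_of_ge hg hη h2, stripExtend_of_ge hg hη (him ▸ h2), ← him] at hzw
        exact (hbot _ (collarParam_mem η _)).1 (congrArg Complex.re hzw)
  · intro w
    by_cases hw : w.im ∈ Icc (-1 : ℝ) 1
    · exact ⟨stripEmb (gt.symm (stripPt w)), by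
        rw [stripExtend_stripEmb hη, gt.apply_symm_apply, stripEmb_stripPt hw]⟩
    · rcases lt_or_ge 1 w.im with h1 | h1
      · obtain ⟨x, hx⟩ := (htop _ (collarParam_mem η (w.im - 1))).2 w.re
        exact ⟨⟨x, w.im⟩, by rw [stripExtend_of_le hg hη (z := ⟨x, w.im⟩) h1.le]; exact Complex.ext hx rfl⟩
      · have h2 : w.im ≤ -1 := not_lt.1 fun h2 ↦ hw ⟨h2.le, h1⟩
        obtain ⟨x, hx⟩ := (hbot _ (collarParam_mem η (-1 - w.im))).2 w.re
        exact ⟨⟨x, w.im⟩, by rw [stripExtend_of_ge hg hη (z := ⟨x, w.im⟩) h2]; exact Complex.ext hx rfl⟩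

theorem exists_bound_stripExtend {gt : AnnulusCover ≃ₜ AnnulusCover} (hg : IsStripMap gt) (η : ℝ)
    (s₁ s₂ : ℝ) :
    ∃ M, ∀ z, |(stripExtend gt η s₁ s₂ z).re - z.re| ≤ M := by
  obtain ⟨M, hM⟩ := IsStripMap.exists_bound hg.shift
  refine ⟨M + (|s₁| + M) + (|s₂| + M), fun z ↦ ?_⟩
  have h0 : |(gt (stripPt z)).1 - z.re| ≤ M := hM (stripPt z)
  have key : ∀ t s : ℝ, t ∈ Icc (0 : ℝ) 1 → |t * (z.re + s - (gt (stripPt z)).1)| ≤ |s| + M := by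
    intro t s ht
    rw [abs_mul, abs_of_nonneg ht.1]
    refine (mul_le_of_le_one_left (abs_nonneg _) ht.2).trans ?_
    rw [show z.re + s - (gt (stripPt z)).1 = s - ((gt (stripPt z)).1 - z.re) by ring]
    exact (abs_sub _ _).trans (by linarith)
  have e : (stripExtend gt η s₁ s₂ z).re - z.re = ((gt (stripPt z)).1 - z.re)
      + collarParam η (z.im - 1) * (z.re + s₁ - (gt (stripPt z)).1)
      + collarParam η (-1 - z.im) * (z.re + s₂ - (gt (stripPt z)).1) := by
    simp only [stripExtend, collarParam]; ring
  rw [e]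
  refine (abs_add_le _ _).trans (add_le_add ((abs_add_le _ _).trans (add_le_add h0 ?_)) ?_)
  · exact key _ _ (collarParam_mem _ _)
  · exact key _ _ (collarParam_mem _ _)

theorem exists_homeomorph_stripExtend {gt : AnnulusCover ≃ₜ AnnulusCover} (hg : IsStripMap gt) {η : ℝ}
    (hη : 0 < η) (s₁ s₂ : ℝ) :
    ∃ h : ℂ ≃ₜ ℂ, HasSymmLog h ∧ ∀ z, h z = stripExtend gt η s₁ s₂ z := by
  obtain ⟨M, hM⟩ := exists_bound_stripExtend hg η s₁ s₂
  have hc := continuous_stripExtend gt.continuous η s₁ s₂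
  have hb := bijective_stripExtend hg hη s₁ s₂
  obtain ⟨h, hh⟩ := isHomeomorph_of_bounded_displacement (M := M + 2) hc hb (fun z ↦ by
    refine (Complex.norm_le_abs_re_add_abs_im _).trans (add_le_add (hM z) ?_)
    by_cases hz : z.im ∈ Icc (-1 : ℝ) 1
    · have h' := (stripExtend_im_mem hg hη s₁ s₂).2 hz
      rw [Complex.sub_im, abs_le]
      constructor <;> linarith [hz.1, hz.2, h'.1, h'.2]
    · rw [Complex.sub_im, stripExtend_im_of_notMem hg hη s₁ s₂ hz]; simp)
  refine ⟨h, ?_, hh⟩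
  have : (h : ℂ → ℂ) = stripExtend gt η s₁ s₂ := funext hh
  rw [this]
  refine .of_bounded_re hc hb.1 hM fun x y hx hy ↦ ?_
  rw [stripExtend_of_le hg hη hx, stripExtend_of_ge hg hη hy]
  simp only
  linarith

theorem not_continuousOn_log_sphere (c : ℂ) {r : ℝ} (hr : 0 < r) (m : ℂ → ℂ)
    (hm : ContinuousOn m (Metric.sphere c r))
    (he : ∀ v ∈ Metric.sphere c r, Complex.exp (m v) = v - c) : False := by
  have hmem : ∀ θ : ℝ, circleMap c r θ ∈ Metric.sphere c r := circleMap_mem_sphere c hr.le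
  have key := log_sub_log_const (Z := (univ : Set ℝ)) (c := r) isPreconnected_univ
    (a := fun θ ↦ m (circleMap c r θ)) (b := fun θ ↦ θ * Complex.I)
    (hm.comp (continuous_circleMap c r).continuousOn fun θ _ ↦ hmem θ)
    (by fun_prop) (fun θ _ ↦ by rw [he _ (hmem θ), circleMap_sub_center, circleMap_zero])
    (mem_univ 0) (mem_univ (2 * Real.pi))
  have e : circleMap c r (2 * Real.pi) = circleMap c r 0 := by
    simpa using periodic_circleMap c r 0
  rw [e] at key
  have : ((2 * Real.pi : ℝ) : ℂ) * Complex.I = 0 := by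
    have := sub_right_injective key
    simpa using this.symm
  have h2 := Complex.two_pi_I_ne_zero
  push_cast at this
  exact h2 this

/-- Homeomorphisms of the strip preserve its interior. -/
theorem Homeomorph.strip_interior (ft : AnnulusCover ≃ₜ AnnulusCover) (z : AnnulusCover)
    (hz : |(z.2 : ℝ)| < 1) : |((ft z).2 : ℝ)| < 1 := by
  by_contra hw
  set w := ft z with hwz
  have hw1 : |(w.2 : ℝ)| = 1 := le_antisymm (abs_le.2 w.2.2) (not_lt.1 hw)
  let Z : Set ℂ := {u | u.im ∈ Icc (-1 : ℝ) 1 ∧ u ≠ stripEmb w}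
  let c : ℂ := ⟨w.1, 0⟩
  have hcZ : c ∈ Z := by
    refine ⟨by simp [c], fun h ↦ ?_⟩
    have := congrArg Complex.im h
    simp only [c, stripEmb] at this
    rw [← this] at hw1
    simp at hw1
  have hZ : StarConvex ℝ c Z := by
    intro u hu a b ha hb hab
    have him : (a • c + b • u).im = b * u.im := by simp [c]
    refine ⟨?_, fun h ↦ ?_⟩
    · rw [him]
      constructor <;> nlinarith [hu.1.1, hu.1.2]
    · have h1 : b * u.im = w.2 := by rw [← him, h]; rfl
      have h2 : |b * u.im| = 1 := by rw [h1, hw1]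
      have h3 : |u.im| ≤ 1 := abs_le.2 hu.1
      rw [abs_mul, abs_of_nonneg hb] at h2
      have hb1 : b = 1 := by nlinarith [abs_nonneg u.im]
      have ha0 : a = 0 := by linarith
      rw [hb1, ha0, zero_smul, one_smul, zero_add] at h
      exact hu.2 h
  obtain ⟨l, lc, le⟩ := exists_continuousOn_log hZ hcZ
    (g := fun u ↦ stripEmb (ft.symm (stripPt u)) - stripEmb z)
    (((continuous_stripEmb.comp (ft.symm.continuous.comp continuous_stripPt)).sub
      continuous_const).continuousOn) (fun u hu h ↦ by
      have h1 := stripEmb_injective (sub_eq_zero.1 h)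
      rw [Homeomorph.symm_apply_eq] at h1
      exact hu.2 (by rw [hwz, ← h1, stripEmb_stripPt hu.1]))
  have hr : 0 < 1 - |(z.2 : ℝ)| := by linarith
  have hsph : ∀ v ∈ Metric.sphere (stripEmb z) (1 - |(z.2 : ℝ)|),
      v.im ∈ Icc (-1 : ℝ) 1 ∧ v ≠ stripEmb z := by
    intro v hv
    refine ⟨?_, Metric.ne_of_mem_sphere hv hr.ne'⟩
    rw [mem_sphere_iff_norm] at hv
    have h1 := Complex.abs_im_le_norm (v - stripEmb z)
    rw [hv, Complex.sub_im] at h1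
    have h2 : |v.im - z.2| ≤ 1 - |(z.2 : ℝ)| := h1
    have h3 := abs_sub_abs_le_abs_sub v.im z.2
    exact abs_le.1 (by linarith)
  have hmaps : ∀ v ∈ Metric.sphere (stripEmb z) (1 - |(z.2 : ℝ)|),
      stripEmb (ft (stripPt v)) ∈ Z := fun v hv ↦ by
    refine ⟨(ft (stripPt v)).2.2, fun h ↦ (hsph v hv).2 ?_⟩
    rw [← ft.injective (stripEmb_injective h), stripEmb_stripPt (hsph v hv).1]
  refine not_continuousOn_log_sphere (stripEmb z) hr (fun v ↦ l (stripEmb (ft (stripPt v)))) ?_ ?_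
  · exact lc.comp (continuous_stripEmb.comp
      (ft.continuous.comp continuous_stripPt)).continuousOn hmaps
  · intro v hv
    rw [le _ (hmaps v hv)]
    simp only [stripPt_stripEmb, ft.symm_apply_apply, stripEmb_stripPt (hsph v hv).1]

theorem Homeomorph.strip_boundary (ft : AnnulusCover ≃ₜ AnnulusCover) (z : AnnulusCover) :
    |((ft z).2 : ℝ)| = 1 ↔ |(z.2 : ℝ)| = 1 := by
  have h : ∀ z : AnnulusCover, |(z.2 : ℝ)| = 1 ↔ ¬ |(z.2 : ℝ)| < 1 := fun z ↦
    ⟨fun h ↦ h.not_lt, fun h ↦ le_antisymm (abs_le.2 z.2.2) (not_lt.1 h)⟩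
  rw [h, h, not_iff_not]
  refine ⟨fun h' ↦ ?_, ft.strip_interior z⟩
  simpa using ft.symm.strip_interior (ft z) h'

theorem eq_or_eq_of_abs_eq_one {σ : ℝ → ℝ} (hc : Continuous σ) (h : ∀ x, |σ x| = 1) (x y : ℝ) :
    σ x = σ y := by
  have h1 := fun x ↦ (abs_eq zero_le_one).1 (h x)
  by_contra hne
  have h0 : (0 : ℝ) ∈ range σ := by
    rcases h1 x with hx | hx <;> rcases h1 y with hy | hy
    · exact absurd (hx.trans hy.symm) hne
    · exact mem_range_of_exists_le_of_exists_ge hc ⟨y, by linarith⟩ ⟨x, by linarith⟩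
    · exact mem_range_of_exists_le_of_exists_ge hc ⟨x, by linarith⟩ ⟨y, by linarith⟩
    · exact absurd (hx.trans hy.symm) hne
  obtain ⟨t, ht⟩ := h0
  have := h t
  rw [ht] at this
  simp at this

theorem isStripMap_sq {ft : AnnulusCover ≃ₜ AnnulusCover}
    (h : ∀ z : AnnulusCover, ft (z.1 + 1, z.2) = ((ft z).1 + 1, (ft z).2)) :
    IsStripMap (ft * ft) := by
  let P : Icc (-1 : ℝ) 1 := ⟨1, by norm_num⟩
  let N : Icc (-1 : ℝ) 1 := ⟨-1, by norm_num⟩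
  have hP := fun x : ℝ ↦ (ft.strip_boundary (x, P)).2 (by simp [P])
  have hN := fun x : ℝ ↦ (ft.strip_boundary (x, N)).2 (by simp [N])
  have cP := eq_or_eq_of_abs_eq_one (by fun_prop) hP
  have cN := eq_or_eq_of_abs_eq_one (by fun_prop) hN
  have hsign : ∀ z : AnnulusCover, |(z.2 : ℝ)| = 1 → z = (z.1, P) ∨ z = (z.1, N) := by
    intro z hz
    rcases (abs_eq zero_le_one).1 hz with h | h
    · exact Or.inl (Prod.ext rfl (Subtype.ext h))
    · exact Or.inr (Prod.ext rfl (Subtype.ext h))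
  have hopp : ∀ x y, ((ft (x, P)).2 : ℝ) = -(ft (y, N)).2 := by
    intro x y
    by_contra hne
    have heq : ((ft (x, P)).2 : ℝ) = (ft (y, N)).2 := by
      rcases (abs_eq zero_le_one).1 (hP x) with h | h <;>
        rcases (abs_eq zero_le_one).1 (hN y) with h' | h' <;>
          rw [h, h'] at hne ⊢ <;> norm_num at hne
    have hall : ∀ z : AnnulusCover, |(z.2 : ℝ)| = 1 → ((ft z).2 : ℝ) = (ft (x, P)).2 := by
      intro z hz
      rcases hsign z hz with h | h
      · rw [h]; exact cP _ _
      · rw [h, heq]; exact cN _ _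
    let v : AnnulusCover := (0, ⟨-(ft (x, P)).2, neg_mem_Icc_iff.2 (by simp)⟩)
    have hv : |(v.2 : ℝ)| = 1 := by simp only [v, abs_neg]; exact hP x
    have := hall (ft.symm v) (by rw [← ft.strip_boundary, ft.apply_symm_apply, hv])
    rw [ft.apply_symm_apply] at this
    simp only [v] at this
    have h1 := hP x
    rw [show ((ft (x, P)).2 : ℝ) = 0 by linarith] at h1
    simp at h1
  have hsq : ∀ z : AnnulusCover, |(z.2 : ℝ)| = 1 → (((ft * ft) z).2 : ℝ) = z.2 := by
    intro z hz
    have hz' := (ft.strip_boundary z).2 hz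
    change ((ft (ft z)).2 : ℝ) = z.2
    rcases hsign z hz with e | e <;> rcases hsign _ hz' with e' | e'
    · rw [e', cP _ z.1, ← e, e', e]
    · rw [e', ← neg_eq_iff_eq_neg.2 (hopp z.1 (ft z).1), ← e, e', e]; simp [P, N]
    · rw [e', hopp _ z.1, ← e, e', e]
    · rw [e', cN _ z.1, ← e, e', e]
  have hbd := (ft * ft).strip_boundary
  refine ⟨fun z ↦ ?_, fun z ↦ ⟨fun hz ↦ ?_, fun hz ↦ ?_⟩, fun z ↦ ⟨fun hz ↦ ?_, fun hz ↦ ?_⟩⟩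
  · change ft (ft _) = _
    rw [h, h (ft z)]
    rfl
  · rw [← hsq z ((hbd z).1 (by rw [hz]; simp)), hz]
  · rw [hsq z (by simp [hz]), hz]
  · rw [← hsq z ((hbd z).1 (by rw [hz]; simp)), hz]
  · rw [hsq z (by simp [hz]), hz]

theorem homeomorph_pow_apply {X : Type*} [TopologicalSpace X] (g : X ≃ₜ X) (n : ℕ) (x : X) :
    (g ^ n) x = g^[n] x := by
  induction n with
  | zero => rfl
  | succ n ih => rw [pow_succ', Homeomorph.mul_apply, ih, Function.iterate_succ_apply']

/-- The deck transformation `(x, y) ↦ (x + 1, y)` of the strip. -/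
def deck : AnnulusCover ≃ₜ AnnulusCover := (Homeomorph.addRight (1 : ℝ)).prodCongr (.refl _)

theorem deck_apply (z : AnnulusCover) : deck z = (z.1 + 1, z.2) := rfl

theorem deck_zpow_apply (n : ℤ) (z : AnnulusCover) : (deck ^ n) z = (z.1 + n, z.2) := by
  induction n using Int.induction_on with
  | zero => simp
  | succ i ih =>
    rw [add_comm, zpow_add, zpow_one, Homeomorph.mul_apply, ih, deck_apply]
    push_cast
    rw [add_assoc, add_comm (1 : ℝ)]
  | pred i ih =>
    have h : deck ((deck ^ (-(i : ℤ) - 1)) z) = (deck ^ (-(i : ℤ))) z := by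
      rw [← Homeomorph.mul_apply, ← zpow_one_add]; congr 2; ring
    apply deck.injective
    rw [h, ih, deck_apply]
    push_cast
    ring_nf

theorem annulusProj_deck_zpow (n : ℤ) (z : AnnulusCover) :
    annulusProj ((deck ^ n) z) = annulusProj z := by
  rw [deck_zpow_apply, annulusProj, annulusProj]
  refine Prod.ext ?_ rfl
  simp only [AddCircle.coe_add]
  have : ((n : ℝ) : AddCircle (1 : ℝ)) = 0 := by
    rw [AddCircle.coe_eq_zero_iff]
    exact ⟨n, by simp⟩
  rw [this, add_zero]

theorem annulusProj_eq_iff {z w : AnnulusCover} :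
    annulusProj z = annulusProj w ↔ ∃ n : ℤ, z = (deck ^ n) w := by
  constructor
  · intro h
    have h1 := congrArg (fun p : Annulus ↦ p.1) h
    have h2 : z.2 = w.2 := congrArg (fun p : Annulus ↦ p.2) h
    simp only [annulusProj] at h1
    rw [← sub_eq_zero, ← AddCircle.coe_sub, AddCircle.coe_eq_zero_iff] at h1
    obtain ⟨n, hn⟩ := h1
    refine ⟨n, ?_⟩
    rw [deck_zpow_apply]
    refine Prod.ext ?_ h2
    simp only [mul_one, zsmul_eq_mul] at hn ⊢
    linarith
  · rintro ⟨n, rfl⟩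
    exact annulusProj_deck_zpow n w

theorem annulusProj_surjective : Function.Surjective annulusProj := by
  rintro ⟨a, y⟩
  obtain ⟨x, rfl⟩ := QuotientAddGroup.mk_surjective a
  exact ⟨(x, y), rfl⟩

theorem continuous_annulusProj : Continuous annulusProj :=
  ((AddCircle.continuous_mk' 1).comp continuous_fst).prodMk continuous_snd

theorem isOpenMap_annulusProj : IsOpenMap annulusProj :=
  (QuotientAddGroup.isOpenMap_coe).prodMap IsOpenMap.id

theorem IsStripMap.one : IsStripMap 1 := ⟨fun _ ↦ rfl, fun _ ↦ Iff.rfl, fun _ ↦ Iff.rfl⟩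

theorem IsStripMap.mul {g h : AnnulusCover ≃ₜ AnnulusCover} (hg : IsStripMap g)
    (hh : IsStripMap h) : IsStripMap (g * h) :=
  ⟨fun z ↦ by
    rw [Homeomorph.mul_apply, hh.shift, Homeomorph.mul_apply, ← hg.shift],
    fun z ↦ (hg.top _).trans (hh.top z), fun z ↦ (hg.bot _).trans (hh.bot z)⟩

theorem IsStripMap.pow {g : AnnulusCover ≃ₜ AnnulusCover} (hg : IsStripMap g) (n : ℕ) :
    IsStripMap (g ^ n) := by
  induction n with
  | zero => exact .one
  | succ n ih => rw [pow_succ]; exact ih.mul hg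

theorem isStripMap_deck_zpow (n : ℤ) : IsStripMap (deck ^ n) := by
  refine ⟨fun z ↦ ?_, fun z ↦ ?_, fun z ↦ ?_⟩
  · rw [deck_zpow_apply, deck_zpow_apply]
    exact Prod.ext (by simp only; ring) rfl
  · rw [deck_zpow_apply]
  · rw [deck_zpow_apply]

theorem commute_deck {g : AnnulusCover ≃ₜ AnnulusCover}
    (h : ∀ z : AnnulusCover, g (z.1 + 1, z.2) = ((g z).1 + 1, (g z).2)) : Commute deck g :=
  Homeomorph.ext fun z ↦ (h z).symm

/-- `gt` is a lift of the area preserving NICIS homeomorphism `g`, preserving both boundary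
lines. -/
structure IsGoodPair (g : Annulus ≃ₜ Annulus) (gt : AnnulusCover ≃ₜ AnnulusCover) : Prop where
  strip : IsStripMap gt
  proj : ∀ z, g (annulusProj z) = annulusProj (gt z)
  area : MeasurePreserving g volume volume
  nicis : NICIS g

theorem apply_mem_annulusInt {f : Annulus ≃ₜ Annulus} {ft : AnnulusCover ≃ₜ AnnulusCover}
    (h : ∀ z, f (annulusProj z) = annulusProj (ft z)) {z : Annulus} (hz : z ∈ annulusInt) :
    f z ∈ annulusInt := by
  obtain ⟨w, rfl⟩ := annulusProj_surjective z
  rw [h]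
  exact abs_lt.1 (ft.strip_interior w (abs_lt.2 hz))

theorem pow_apply_mem_annulusInt {f : Annulus ≃ₜ Annulus} {ft : AnnulusCover ≃ₜ AnnulusCover}
    (h : ∀ z, f (annulusProj z) = annulusProj (ft z)) (n : ℕ) {z : Annulus}
    (hz : z ∈ annulusInt) : (f ^ n) z ∈ annulusInt := by
  induction n with
  | zero => exact hz
  | succ n ih => rw [pow_succ']; exact apply_mem_annulusInt h ih

theorem NICIS.pow {f : Annulus ≃ₜ Annulus} {ft : AnnulusCover ≃ₜ AnnulusCover}
    (h : ∀ z, f (annulusProj z) = annulusProj (ft z)) (hf : NICIS f) {n : ℕ} (hn : n ≠ 0) :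
    NICIS (f ^ n) := by
  rintro ⟨K, hne, hK, hinv, hint⟩
  refine hf ⟨⋃ i ∈ Finset.range n, (f ^ i) '' K, ?_, ?_, ?_, ?_⟩
  · obtain ⟨z, hz⟩ := hne
    exact ⟨z, mem_biUnion (Finset.mem_range.2 (Nat.pos_of_ne_zero hn)) ⟨z, hz, rfl⟩⟩
  · exact (Finset.range n).isCompact_biUnion fun i _ ↦ hK.image (f ^ i).continuous
  · obtain ⟨m, rfl⟩ := Nat.exists_eq_succ_of_ne_zero hn
    have hs : ∀ i : ℕ, f '' ((f ^ i : Annulus ≃ₜ Annulus) '' K)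
        = (f ^ (i + 1) : Annulus ≃ₜ Annulus) '' K := fun i ↦ by
      rw [image_image, pow_succ']; rfl
    simp only [image_iUnion, hs, Finset.mem_range]
    ext z
    simp only [mem_iUnion, exists_prop]
    constructor
    · rintro ⟨i, hi, hz⟩
      rcases (Nat.succ_le_of_lt hi).lt_or_eq with h' | h'
      · exact ⟨i + 1, h', hz⟩
      · refine ⟨0, by omega, ?_⟩
        rw [show i + 1 = m.succ from h', hinv] at hz
        exact ⟨z, hz, rfl⟩
    · rintro ⟨i, hi, hz⟩
      rcases Nat.eq_zero_or_pos i with rfl | h'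
      · refine ⟨m, by omega, ?_⟩
        rw [show m + 1 = m.succ from rfl, hinv]
        obtain ⟨w, hw, rfl⟩ := hz
        exact hw
      · exact ⟨i - 1, by omega, by rwa [Nat.sub_add_cancel h']⟩
  · refine iUnion₂_subset fun i _ ↦ ?_
    rintro _ ⟨z, hz, rfl⟩
    exact pow_apply_mem_annulusInt h i (hint hz)

theorem annulusProj_pow {f : Annulus ≃ₜ Annulus} {ft : AnnulusCover ≃ₜ AnnulusCover}
    (h : ∀ z, f (annulusProj z) = annulusProj (ft z)) (n : ℕ) (z : AnnulusCover) :
    (f ^ n) (annulusProj z) = annulusProj ((ft ^ n) z) := by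
  induction n with
  | zero => rfl
  | succ n ih => rw [pow_succ', pow_succ', Homeomorph.mul_apply, ih, h]; rfl

theorem measurePreserving_pow {f : Annulus ≃ₜ Annulus} {μ : Measure Annulus}
    (h : MeasurePreserving f μ μ) (n : ℕ) : MeasurePreserving (f ^ n : Annulus ≃ₜ Annulus) μ μ := by
  induction n with
  | zero => exact MeasurePreserving.id _
  | succ n ih => rw [pow_succ']; exact h.comp ih

theorem isGoodPair_of_isLift {f : Annulus ≃ₜ Annulus} {ft : AnnulusCover ≃ₜ AnnulusCover}
    (harea : MeasurePreserving f volume volume) (hlift : IsLift f ft) (hnicis : NICIS f) {q : ℕ}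
    (hq : q ≠ 0) (p : ℤ) : IsGoodPair (f ^ (2 * q)) (deck ^ (-p) * ft ^ (2 * q)) where
  strip := by
    refine (isStripMap_deck_zpow _).mul ?_
    rw [pow_mul, sq]
    exact (isStripMap_sq hlift.1).pow q
  proj z := by
    rw [annulusProj_pow hlift.2, Homeomorph.mul_apply, annulusProj_deck_zpow]
  area := measurePreserving_pow harea _
  nicis := hnicis.pow hlift.2 (by omega)

theorem fst_pow_deck_mul {g : AnnulusCover ≃ₜ AnnulusCover}
    (h : ∀ z : AnnulusCover, g (z.1 + 1, z.2) = ((g z).1 + 1, (g z).2)) (p : ℤ) (m n : ℕ)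
    (z : AnnulusCover) :
    (((deck ^ (-p) * g ^ m) ^ n) z).1 - z.1 = ((g ^ (m * n)) z).1 - z.1 - p * n := by
  have hc : Commute (deck ^ (-p)) (g ^ m) := ((commute_deck h).zpow_left _).pow_right _
  rw [hc.mul_pow, ← pow_mul, ← zpow_natCast (deck ^ (-p)), ← zpow_mul, Homeomorph.mul_apply,
    deck_zpow_apply]
  push_cast
  ring

theorem fst_pow_sub_eq_birkhoffSum {f : Annulus ≃ₜ Annulus} {ft : AnnulusCover ≃ₜ AnnulusCover}
    (h : ∀ z, f (annulusProj z) = annulusProj (ft z)) {F : Annulus → ℝ}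
    (hF : ∀ z : AnnulusCover, F (annulusProj z) = (ft z).1 - z.1) (n : ℕ) (z : AnnulusCover) :
    ((ft ^ n) z).1 - z.1 = birkhoffSum f F n (annulusProj z) := by
  induction n with
  | zero => simp
  | succ n ih =>
    rw [birkhoffSum_succ, ← ih]
    have : f^[n] (annulusProj z) = annulusProj ((ft ^ n) z) := by
      rw [← annulusProj_pow h, homeomorph_pow_apply]
    rw [this, hF, pow_succ', Homeomorph.mul_apply]
    ring

theorem HasSymmLog.of_comp {κ h : ℂ → ℂ} (hκ : HasSymmLog κ) (hc : Continuous h)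
    (hi : Function.Injective h) (hκh : HasSymmLog (κ ∘ h)) : HasSymmLog h := by
  obtain ⟨l, lc, le, ls⟩ := hκ
  obtain ⟨m, mc, me, ms⟩ := hκh
  refine ⟨fun p ↦ m p - l (h p.1, h p.2), ?_, fun p hp ↦ ?_, fun x y hxy ↦ ?_⟩
  · refine mc.sub (lc.comp (t := {p : ℂ × ℂ | p.1 ≠ p.2}) (by fun_prop) fun p hp ↦ ?_)
    exact hi.ne hp
  · have h1 := le (h p.1, h p.2) (hi.ne hp)
    have h2 := me p hp
    simp only [Function.comp_apply] at h1 h2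
    rw [← h1] at h2
    rw [Complex.exp_sub, div_mul_eq_mul_div, h2, mul_div_cancel_left₀ _ (Complex.exp_ne_zero _)]
  · simp only [ms x y hxy, ls (h x) (h y) (hi.ne hxy)]

/-- Compression of the real line onto `(-1, 1)`. -/
def squash (t : ℝ) : ℝ := t / (1 + |t|)

theorem continuous_squash : Continuous squash :=
  continuous_id.div (by fun_prop) fun t ↦ by positivity

theorem abs_squash (t : ℝ) : |squash t| = |t| / (1 + |t|) := by
  rw [squash, abs_div, abs_of_pos (by positivity : 0 < 1 + |t|)]

theorem abs_squash_lt (t : ℝ) : |squash t| < 1 := by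
  rw [abs_squash, div_lt_one (by positivity)]
  linarith

/-- The inverse of `squash`. -/
def unsquash (s : ℝ) : ℝ := s / (1 - |s|)

theorem continuousOn_unsquash : ContinuousOn unsquash {s | |s| < 1} :=
  continuousOn_id.div (by fun_prop) fun s hs ↦ by
    simp only [mem_ofPred_eq] at hs
    linarith

theorem unsquash_squash (t : ℝ) : unsquash (squash t) = t := by
  rw [unsquash, abs_squash, squash]
  have : 1 + |t| ≠ 0 := by positivity
  field_simp
  simp

theorem squash_unsquash {s : ℝ} (hs : |s| < 1) : squash (unsquash s) = s := by
  have h : 0 < 1 - |s| := by linarith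
  rw [squash, unsquash, abs_div, abs_of_pos h]
  field_simp
  simp

theorem squash_strictMono : StrictMono squash := by
  intro a b hab
  rw [squash, squash, div_lt_div_iff₀ (by positivity) (by positivity)]
  rcases le_total 0 a with ha | ha <;> rcases le_total 0 b with hb | hb <;>
    simp only [abs_of_nonneg, abs_of_nonpos, ha, hb] <;> nlinarith

/-- The homeomorphism from the plane to the open strip. -/
def toStrip (z : ℂ) : AnnulusCover :=
  (z.re, ⟨squash z.im, (abs_le.1 (abs_squash_lt _).le)⟩)

/-- The inverse of `toStrip`. -/
def ofStrip (z : AnnulusCover) : ℂ := ⟨z.1, unsquash z.2⟩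

theorem continuous_toStrip : Continuous toStrip :=
  Complex.continuous_re.prodMk ((continuous_squash.comp Complex.continuous_im).subtype_mk _)

theorem continuousOn_ofStrip : ContinuousOn ofStrip {z | |(z.2 : ℝ)| < 1} := by
  refine Complex.equivRealProdCLM.symm.continuous.comp_continuousOn
    (continuousOn_fst.prodMk (continuousOn_unsquash.comp
      (f := fun z : AnnulusCover ↦ (z.2 : ℝ)) (by fun_prop) fun z hz ↦ hz))

theorem ofStrip_toStrip (z : ℂ) : ofStrip (toStrip z) = z :=
  Complex.ext rfl (unsquash_squash z.im)

theorem toStrip_ofStrip {z : AnnulusCover} (hz : |(z.2 : ℝ)| < 1) : toStrip (ofStrip z) = z :=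
  Prod.ext rfl (Subtype.ext (squash_unsquash hz))

theorem toStrip_mem (z : ℂ) : |((toStrip z).2 : ℝ)| < 1 := abs_squash_lt _

theorem hasSymmLog_toStrip : HasSymmLog (stripEmb ∘ toStrip) := by
  refine .of_mem_slitPlane (continuous_stripEmb.comp continuous_toStrip) fun x y hxy ↦ ?_
  have him : (stripEmb (toStrip x) - stripEmb (toStrip y)).im = squash x.im - squash y.im := rfl
  rcases eq_or_ne x.im y.im with h | h
  · have : (stripEmb ∘ toStrip) x - (stripEmb ∘ toStrip) y = x - y := by
      apply Complex.ext
      · rfl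
      · simp only [Function.comp_apply, him, h, Complex.sub_im, sub_self]
    rw [this, div_self (sub_ne_zero.2 hxy)]
    simp
  · refine mem_slitPlane_div_of_im ?_
    simp only [Function.comp_apply, him, Complex.sub_im]
    rcases h.lt_or_gt with h | h
    · exact mul_pos_of_neg_of_neg (sub_neg.2 (squash_strictMono h)) (sub_neg.2 h)
    · exact mul_pos (sub_pos.2 (squash_strictMono h)) (sub_pos.2 h)

/-- Restriction of a homeomorphism of the strip to its interior, seen on the plane. -/
def stripConj (gt : AnnulusCover ≃ₜ AnnulusCover) : ℂ ≃ₜ ℂ where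
  toFun z := ofStrip (gt (toStrip z))
  invFun z := ofStrip (gt.symm (toStrip z))
  left_inv z := by
    simp only [toStrip_ofStrip (gt.strip_interior _ (toStrip_mem z)), gt.symm_apply_apply,
      ofStrip_toStrip]
  right_inv z := by
    simp only [toStrip_ofStrip (gt.symm.strip_interior _ (toStrip_mem z)), gt.apply_symm_apply,
      ofStrip_toStrip]
  continuous_toFun := continuousOn_ofStrip.comp_continuous (gt.continuous.comp continuous_toStrip)
    fun z ↦ gt.strip_interior _ (toStrip_mem z)
  continuous_invFun := continuousOn_ofStrip.comp_continuous
    (gt.symm.continuous.comp continuous_toStrip) fun z ↦ gt.symm.strip_interior _ (toStrip_mem z)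

theorem toStrip_stripConj (gt : AnnulusCover ≃ₜ AnnulusCover) (z : ℂ) :
    toStrip (stripConj gt z) = gt (toStrip z) :=
  toStrip_ofStrip (gt.strip_interior _ (toStrip_mem z))

theorem toStrip_iterate_stripConj (gt : AnnulusCover ≃ₜ AnnulusCover) (n : ℕ) (z : ℂ) :
    toStrip ((stripConj gt)^[n] z) = (gt ^ n) (toStrip z) := by
  rw [homeomorph_pow_apply]
  induction n with
  | zero => rfl
  | succ n ih =>
    rw [Function.iterate_succ_apply', Function.iterate_succ_apply', toStrip_stripConj, ih]

theorem hasSymmLog_stripConj {gt : AnnulusCover ≃ₜ AnnulusCover} (hg : IsStripMap gt) :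
    HasSymmLog (stripConj gt) := by
  obtain ⟨H, hl, hH⟩ := exists_homeomorph_stripExtend hg one_pos 0 0
  refine hasSymmLog_toStrip.of_comp (stripConj gt).continuous (stripConj gt).injective ?_
  have : (stripEmb ∘ toStrip) ∘ stripConj gt = H ∘ (stripEmb ∘ toStrip) := by
    funext z
    simp only [Function.comp_apply, toStrip_stripConj, hH, stripExtend_stripEmb one_pos]
  rw [this]
  exact hl.comp hasSymmLog_toStrip (continuous_stripEmb.comp continuous_toStrip)
    (stripEmb_injective.comp (Function.LeftInverse.injective ofStrip_toStrip))

theorem IsGoodPair.ne_of_interior {g : Annulus ≃ₜ Annulus} {gt : AnnulusCover ≃ₜ AnnulusCover}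
    (h : IsGoodPair g gt) {z : AnnulusCover} (hz : |(z.2 : ℝ)| < 1) : gt z ≠ z := by
  intro he
  refine h.nicis ⟨{annulusProj z}, singleton_nonempty _, isCompact_singleton, ?_, ?_⟩
  · rw [image_singleton, h.proj, he]
  · rw [singleton_subset_iff]
    exact abs_lt.1 hz

/-- There is a nonempty open set of the strip which is disjoint from its forward iterates. -/
theorem IsGoodPair.exists_wandering {g : Annulus ≃ₜ Annulus} {gt : AnnulusCover ≃ₜ AnnulusCover}
    (h : IsGoodPair g gt) : ∃ D : Set AnnulusCover, IsOpen D ∧ D.Nonempty ∧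
      (∀ z ∈ D, |z.1| ≤ 1) ∧ ∀ n : ℕ, n ≠ 0 → ∀ z ∈ D, (gt ^ n) z ∉ D := by
  have hfix : ∀ z, stripConj gt z ≠ z := fun z hz ↦
    h.ne_of_interior (toStrip_mem z) (by rw [← toStrip_stripConj, hz])
  obtain ⟨U, V, hU, hV, hUm, hVm, hUV⟩ := t2_separation (hfix 0)
  have hW : U.preimage (stripConj gt) ∩ V ∈ nhds (0 : ℂ) :=
    Filter.inter_mem ((stripConj gt).continuous.continuousAt (hU.mem_nhds hUm)) (hV.mem_nhds hVm)
  obtain ⟨r, hr, hrW⟩ := Metric.mem_nhds_iff.1 hW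
  have hwan := fun n (hn : n ≠ 0) x hx ↦ iterate_notMem_of_free (stripConj gt)
    (hasSymmLog_stripConj h.strip) hfix (D := Metric.ball 0 (min r 1)) Metric.isOpen_ball
    (convex_ball _ _).isPreconnected
    (fun z hz hz' ↦ disjoint_left.1 hUV
      (hrW (Metric.ball_subset_ball (min_le_left _ _) hz)).1
      (hrW (Metric.ball_subset_ball (min_le_left _ _) hz')).2) (n := n) hn (x := x) hx
  refine ⟨{z | |(z.2 : ℝ)| < 1} ∩ ofStrip ⁻¹' Metric.ball 0 (min r 1), ?_, ?_, ?_, ?_⟩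
  · exact continuousOn_ofStrip.isOpen_inter_preimage
      (isOpen_lt (by fun_prop) continuous_const) Metric.isOpen_ball
  · refine ⟨toStrip 0, toStrip_mem 0, ?_⟩
    rw [mem_preimage, ofStrip_toStrip]
    exact Metric.mem_ball_self (lt_min hr one_pos)
  · rintro z ⟨-, hz⟩
    rw [mem_preimage, mem_ball_zero_iff] at hz
    exact (Complex.abs_re_le_norm (ofStrip z)).trans (hz.le.trans (min_le_right _ _))
  · rintro n hn z ⟨hz1, hz⟩ ⟨hz2, hz'⟩
    refine hwan n hn _ hz ?_
    rw [mem_preimage] at hz'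
    convert hz' using 1
    rw [← ofStrip_toStrip ((stripConj gt)^[n] _), toStrip_iterate_stripConj, toStrip_ofStrip hz1]

instance instIsFiniteMeasureIcc : IsFiniteMeasure (volume : Measure (Icc (-1 : ℝ) 1)) :=
  ⟨by rw [Measure.Subtype.volume_univ measurableSet_Icc.nullMeasurableSet]; simp⟩

instance instIsOpenPosMeasureIcc :
    (volume : Measure (Icc (-1 : ℝ) 1)).IsOpenPosMeasure := by
  refine ⟨fun U hU ⟨x, hx⟩ h0 ↦ ?_⟩
  obtain ⟨V, hV, rfl⟩ := isOpen_induced_iff.1 hU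
  have hvol : volume (V ∩ Icc (-1 : ℝ) 1) = 0 := by
    have := comap_subtype_coe_apply measurableSet_Icc (volume : Measure ℝ)
      (Subtype.val ⁻¹' V : Set (Icc (-1 : ℝ) 1))
    rw [Subtype.image_preimage_coe, inter_comm] at this
    rw [← this]
    exact h0
  have hx' : (x : ℝ) ∈ closure (Ioo (-1 : ℝ) 1) := by
    rw [closure_Ioo (by norm_num)]; exact x.2
  obtain ⟨y, hyV, hyI⟩ := mem_closure_iff.1 hx' V hV hx
  have : 0 < volume (V ∩ Ioo (-1 : ℝ) 1) := (hV.inter isOpen_Ioo).measure_pos _ ⟨y, hyV, hyI⟩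
  exact (this.trans_le (measure_mono (inter_subset_inter_right _ Ioo_subset_Icc_self))).ne' hvol

instance instIsOpenPosMeasureAnnulus : (volume : Measure Annulus).IsOpenPosMeasure :=
  inferInstanceAs ((volume : Measure (AddCircle (1 : ℝ))).prod
    (volume : Measure (Icc (-1 : ℝ) 1))).IsOpenPosMeasure

instance instIsFiniteMeasureAnnulus : IsFiniteMeasure (volume : Measure Annulus) :=
  inferInstanceAs (IsFiniteMeasure ((volume : Measure (AddCircle (1 : ℝ))).prod
    (volume : Measure (Icc (-1 : ℝ) 1))))

/-- The iterates of a good lift cannot have sublinear displacement. -/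
theorem IsGoodPair.false_of_sublinear {g : Annulus ≃ₜ Annulus} {gt : AnnulusCover ≃ₜ AnnulusCover}
    (h : IsGoodPair g gt)
    (hsub : ∀ ε > 0, ∃ C : ℝ, ∀ (n : ℕ) (z : AnnulusCover), |((gt ^ n) z).1 - z.1| ≤ ε * n + C) :
    False := by
  obtain ⟨D, hD, hDne, hD1, hDw⟩ := h.exists_wandering
  let U := annulusProj '' D
  have hU : IsOpen U := isOpenMap_annulusProj D hD
  have hUpos : 0 < volume.real U := by
    rw [measureReal_def]
    exact ENNReal.toReal_pos (hU.measure_pos _ (hDne.image _)).ne' (measure_ne_top _ _)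
  set A := volume.real (univ : Set Annulus) with hA
  have hA0 : 0 ≤ A := measureReal_nonneg
  obtain ⟨C, hC⟩ := hsub (volume.real U / (4 * (A + 1))) (by positivity)
  set ε := volume.real U / (4 * (A + 1)) with hε
  have hC0 : 0 ≤ C := by simpa using (abs_nonneg _).trans (hC 0 (0, ⟨0, by norm_num⟩))
  have hε0 : 0 < ε := by positivity
  have hcount : ∀ n : ℕ, n * volume.real U ≤ (2 * (ε * n + C + 3) + 1) * A := by
    intro n
    classical
    have hpoint : ∀ w : Annulus,
        (((Finset.range n).filter fun i ↦ (g ^ i).symm w ∈ U).card : ℝ)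
          ≤ 2 * (ε * n + C + 3) + 1 := by
      intro w
      obtain ⟨w', rfl⟩ := annulusProj_surjective w
      obtain ⟨w₀, hw₀, hww⟩ : ∃ w₀ : AnnulusCover, |w₀.1| ≤ 1 ∧ annulusProj w' = annulusProj w₀ := by
        refine ⟨(deck ^ (-⌊w'.1⌋)) w', ?_, (annulusProj_deck_zpow _ _).symm⟩
        rw [deck_zpow_apply]
        push_cast
        rw [← sub_eq_add_neg, Int.self_sub_floor, abs_of_nonneg (Int.fract_nonneg _)]
        exact (Int.fract_lt_one _).le
      rw [hww]
      have hk : ∀ i ∈ (Finset.range n).filter fun i ↦ (g ^ i).symm (annulusProj w₀) ∈ U,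
          ∃ k : ℤ, ∃ z ∈ D, (gt ^ i) z = (deck ^ k) w₀ := by
        intro i hi
        obtain ⟨z, hz, he⟩ := (Finset.mem_filter.1 hi).2
        have : annulusProj ((gt ^ i) z) = annulusProj w₀ := by
          rw [← annulusProj_pow h.proj, he, Homeomorph.apply_symm_apply]
        obtain ⟨k, hk⟩ := annulusProj_eq_iff.1 this
        exact ⟨k, z, hz, hk⟩
      have : Nonempty AnnulusCover := ⟨w₀⟩
      choose! k z hzD hkz using hk
      let L : ℤ := ⌊ε * n + C + 2⌋
      have hL0 : 0 ≤ L := Int.floor_nonneg.2 (by positivity)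
      have hcard := Finset.card_le_card_of_injOn k
        (s := (Finset.range n).filter fun i ↦ (g ^ i).symm (annulusProj w₀) ∈ U)
        (t := Finset.Icc (-L) L) (fun i hi ↦ by
        have h1 := hC i (z i)
        have hi' := Finset.mem_range.1 (Finset.mem_filter.1 hi).1
        rw [hkz i hi, deck_zpow_apply] at h1
        have h2 := abs_le.1 (hD1 _ (hzD i hi))
        have h3 := abs_le.1 hw₀
        have h4 : ε * i ≤ ε * n := by gcongr
        have h1 := abs_le.1 h1
        simp only at h1
        rw [Finset.coe_Icc, mem_Icc, ← abs_le, Int.le_floor, Int.cast_abs, abs_le]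
        constructor <;> linarith [h1.1, h1.2]) (fun i hi j hj hij ↦ by
          have key : ∀ i j : ℕ, i < j → (gt ^ i) (z i) = (gt ^ j) (z j) → z j ∈ D →
              z i ∈ D → False := by
            intro i j hlt he hzj hzi
            refine hDw (j - i) (by omega) _ hzj ?_
            have : (gt ^ i) ((gt ^ (j - i)) (z j)) = (gt ^ i) (z i) := by
              rw [he, ← Homeomorph.mul_apply, ← pow_add]; congr 2; omega
            rwa [(gt ^ i).injective this]
          have he : (gt ^ i) (z i) = (gt ^ j) (z j) := by rw [hkz i hi, hkz j hj, hij]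
          by_contra hne
          rcases lt_or_gt_of_ne hne with hlt | hlt
          · exact key i j hlt he (hzD j hj) (hzD i hi)
          · exact key j i hlt he.symm (hzD i hi) (hzD j hj))
      rw [Int.card_Icc] at hcard
      have h5 : ((L + 1 - -L).toNat : ℤ) = 2 * L + 1 := by
        rw [Int.toNat_of_nonneg (by omega)]; ring
      have h6 : (L : ℝ) ≤ ε * n + C + 2 := Int.floor_le _
      calc _ ≤ ((L + 1 - -L).toNat : ℝ) := by exact_mod_cast hcard
        _ = 2 * L + 1 := by exact_mod_cast h5
        _ ≤ _ := by linarith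
    have hmeas : ∀ i, volume.real ((g ^ i).symm ⁻¹' U) = volume.real U := by
      intro i
      have hmp : MeasurePreserving (g ^ i).symm volume volume :=
        (measurePreserving_pow h.area i).symm (g ^ i).toMeasurableEquiv
      rw [measureReal_def, hmp.measure_preimage hU.measurableSet.nullMeasurableSet, measureReal_def]
    have hint : ∫ w, ∑ i ∈ Finset.range n, ((g ^ i).symm ⁻¹' U).indicator (fun _ ↦ (1 : ℝ)) w
        = n * volume.real U := by
      rw [integral_finsetSum]
      · have : ∀ i ∈ Finset.range n, ∫ w, ((g ^ i).symm ⁻¹' U).indicator (fun _ ↦ (1 : ℝ)) w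
            = volume.real U := fun i _ ↦ by
          rw [integral_indicator_const _ ((hU.preimage (g ^ i).symm.continuous).measurableSet),
            hmeas, smul_eq_mul, mul_one]
        rw [Finset.sum_congr rfl this, Finset.sum_const, Finset.card_range, nsmul_eq_mul]
      · exact fun i _ ↦ (integrable_const _).indicator
          ((hU.preimage (g ^ i).symm.continuous).measurableSet)
    rw [← hint]
    calc _ ≤ ∫ _ : Annulus, (2 * (ε * n + C + 3) + 1) := by
          refine integral_mono (integrable_finsetSum _ fun i _ ↦ (integrable_const _).indicator
            ((hU.preimage (g ^ i).symm.continuous).measurableSet)) (integrable_const _) fun w ↦ ?_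
          refine le_trans (le_of_eq ?_) (hpoint w)
          simp only [indicator_apply, mem_preimage, Finset.sum_boole]
      _ = _ := by rw [integral_const, smul_eq_mul, mul_comm]
  obtain ⟨n, hn⟩ := exists_nat_gt ((2 * (C + 3) + 1) * A / (volume.real U / 2))
  rw [div_lt_iff₀ (by positivity)] at hn
  have h1 := hcount n
  have h2 : ε * A ≤ volume.real U / 4 := by
    rw [hε, div_mul_eq_mul_div, div_le_div_iff₀ (by positivity) (by norm_num)]
    nlinarith
  have h3 : 0 ≤ (n : ℝ) := by positivity
  nlinarith [mul_le_mul_of_nonneg_left h2 h3]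

theorem exists_sign_of_ne_zero {d : ℝ → ℝ} (hc : Continuous d) (hd : ∀ x, d x ≠ 0) :
    ∃ e : ℤ, (e = 1 ∨ e = -1) ∧ ∀ x, 0 < e * d x := by
  rcases lt_or_gt_of_ne (hd 0) with h | h
  · refine ⟨-1, Or.inr rfl, fun x ↦ ?_⟩
    by_contra! hx
    obtain ⟨y, hy⟩ := mem_range_of_exists_le_of_exists_ge hc (c := 0) ⟨0, h.le⟩
      ⟨x, by push_cast at hx; linarith⟩
    exact hd y hy
  · refine ⟨1, Or.inl rfl, fun x ↦ ?_⟩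
    by_contra! hx
    obtain ⟨y, hy⟩ := mem_range_of_exists_le_of_exists_ge hc (c := 0)
      ⟨x, by push_cast at hx; linarith⟩ ⟨0, h.le⟩
    exact hd y hy

theorem le_abs_interpolate {δ d r c : ℝ} {e : ℤ} (hδ : δ ≤ 1 / 2) (he : e = 1 ∨ e = -1)
    (hed : 0 < e * d) (hd : δ ≤ |d|) (hr : 0 ≤ r) (hr' : r ≤ 1 / 2) (hc : c ∈ Icc (0 : ℝ) 1) :
    δ ≤ |(1 - c) * d + c * (e + r)| := by
  obtain ⟨h0, h1⟩ := hc
  rcases he with rfl | rfl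
  · push_cast at *
    rw [one_mul] at hed
    rw [abs_of_pos hed] at hd
    refine le_trans ?_ (le_abs_self _)
    nlinarith [mul_nonneg h0 hr, mul_le_mul_of_nonneg_left hd (sub_nonneg.2 h1)]
  · push_cast at *
    have hed' : d < 0 := by linarith
    rw [abs_of_neg hed'] at hd
    refine le_trans ?_ (neg_le_abs _)
    nlinarith [mul_nonneg h0 (sub_nonneg.2 hr'), mul_le_mul_of_nonneg_left hd (sub_nonneg.2 h1)]

/-- A lift without fixed points extends to the plane, with a displacement bounded away from zero
uniformly in the width of the collars. -/
theorem IsStripMap.exists_extension {gt : AnnulusCover ≃ₜ AnnulusCover} (h : IsStripMap gt)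
    (hfix : ∀ z, gt z ≠ z) :
    ∃ δ > 0, ∀ N : ℕ, 0 < N → ∃ H : ℂ ≃ₜ ℂ, HasSymmLog H ∧
      (∀ z, H (stripEmb z) = stripEmb (gt z)) ∧ (∀ z, H (z + 1) = H z + 1) ∧
      (∀ z, δ ≤ ‖H z - z‖) ∧ ∃ e₁ e₂ : ℤ,
        (∀ z : ℂ, 1 + 1 / (2 * N) ≤ z.im → H z = z + e₁ + ((1 / (2 * N) : ℝ) : ℂ)) ∧
        ∀ z : ℂ, z.im ≤ -1 - 1 / (2 * N) → H z = z + e₂ + ((1 / (2 * N) : ℝ) : ℂ) := by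
  obtain ⟨z₀, _, hz₀⟩ := exists_bound_of_periodic
    (F := fun z ↦ ‖stripEmb (gt z) - stripEmb z‖)
    ((continuous_stripEmb.comp gt.continuous).sub continuous_stripEmb).norm (fun z n ↦ by
      rw [shift_int h.shift]
      congr 1
      apply Complex.ext <;> simp [stripEmb])
  set δ₀ := ‖stripEmb (gt z₀) - stripEmb z₀‖
  have hδ₀ : 0 < δ₀ := norm_pos_iff.2 (sub_ne_zero.2 (stripEmb_injective.ne (hfix z₀)))
  have hbd : ∀ (x y : ℝ) (hy : y ∈ Icc (-1 : ℝ) 1), ((gt (x, ⟨y, hy⟩)).2 : ℝ) = y →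
      δ₀ ≤ |(gt (x, ⟨y, hy⟩)).1 - x| := by
    intro x y hy he
    refine (hz₀ (x, ⟨y, hy⟩)).1.trans ((Complex.norm_le_abs_re_add_abs_im _).trans (le_of_eq ?_))
    simp [stripEmb, he]
  have htop : ∀ x : ℝ, ((gt (x, ⟨1, by norm_num⟩)).2 : ℝ) = 1 := fun x ↦ (h.top _).2 rfl
  have hbot : ∀ x : ℝ, ((gt (x, ⟨-1, by norm_num⟩)).2 : ℝ) = -1 := fun x ↦ (h.bot _).2 rfl
  obtain ⟨e₁, he₁, hd₁⟩ := exists_sign_of_ne_zero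
    (d := fun x ↦ (gt (x, ⟨1, by norm_num⟩)).1 - x) (by fun_prop) (fun x hx ↦ by
      have := hbd x 1 (by norm_num) (htop x)
      rw [hx, abs_zero] at this
      linarith)
  obtain ⟨e₂, he₂, hd₂⟩ := exists_sign_of_ne_zero
    (d := fun x ↦ (gt (x, ⟨-1, by norm_num⟩)).1 - x) (by fun_prop) (fun x hx ↦ by
      have := hbd x (-1) (by norm_num) (hbot x)
      rw [hx, abs_zero] at this
      linarith)
  refine ⟨min δ₀ (1 / 2), by positivity, fun N hN ↦ ?_⟩
  have hN' : (1 : ℝ) ≤ N := by exact_mod_cast hN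
  set r : ℝ := 1 / (2 * N) with hr
  have hr0 : 0 < r := by positivity
  have hr1 : r ≤ 1 / 2 := by
    rw [hr]; gcongr; linarith
  obtain ⟨H, hl, hH⟩ := exists_homeomorph_stripExtend h hr0 (e₁ + r) (e₂ + r)
  refine ⟨H, hl, fun z ↦ by rw [hH, stripExtend_stripEmb hr0], fun z ↦ ?_, fun z ↦ ?_,
    e₁, e₂, fun z hz ↦ ?_, fun z hz ↦ ?_⟩
  · have e : stripPt (z + 1) = ((stripPt z).1 + 1, (stripPt z).2) := by simp [stripPt]
    rw [hH, hH, stripExtend, stripExtend, e, h.shift]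
    apply Complex.ext <;> simp
    ring
  · rw [hH]
    rcases le_total 1 z.im with hz | hz
    · rw [stripExtend_of_le h hr0 hz]
      refine le_trans ?_ (Complex.abs_re_le_norm _)
      rw [Complex.sub_re]
      refine (le_abs_interpolate (min_le_right δ₀ _) he₁ (hd₁ z.re)
        ((min_le_left _ _).trans (hbd z.re 1 _ (htop z.re))) hr0.le hr1
        (collarParam_mem r (z.im - 1))).trans_eq (congrArg _ ?_)
      ring
    rcases le_total z.im (-1) with hz' | hz'
    · rw [stripExtend_of_ge h hr0 hz']
      refine le_trans ?_ (Complex.abs_re_le_norm _)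
      rw [Complex.sub_re]
      refine (le_abs_interpolate (min_le_right δ₀ _) he₂ (hd₂ z.re)
        ((min_le_left _ _).trans (hbd z.re (-1) _ (hbot z.re))) hr0.le hr1
        (collarParam_mem r (-1 - z.im))).trans_eq (congrArg _ ?_)
      ring
    · rw [← stripEmb_stripPt ⟨hz', hz⟩, stripExtend_stripEmb hr0]
      exact (min_le_left _ _).trans (hz₀ _).1
  · rw [hH, stripExtend_of_le h hr0 (by linarith), collarParam_eq_one hr0 (by linarith)]
    apply Complex.ext <;> simp
    ring
  · rw [hH, stripExtend_of_ge h hr0 (by linarith), collarParam_eq_one hr0 (by linarith)]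
    apply Complex.ext <;> simp
    ring

/-- The open rectangles of width `1 / N` and height `2 / N` of a tiling of a neighbourhood of the
strip; the rows of index `0` and `N` straddle the boundary lines. -/
def tile (N : ℕ) (t : ℤ × Fin (N + 1)) : Set ℂ :=
  {z | ((t.1 : ℝ) < N * z.re ∧ N * z.re < t.1 + 1) ∧
    2 * ((t.2 : ℕ) : ℝ) - 1 < N * (z.im + 1) ∧ N * (z.im + 1) < 2 * ((t.2 : ℕ) : ℝ) + 1}

/-- The action of the deck transformation on the tiles. -/
def tileShift (N : ℕ) : Equiv.Perm (ℤ × Fin (N + 1)) :=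
  (Equiv.addRight (N : ℤ)).prodCongr (Equiv.refl _)

theorem tileShift_zpow_apply {N : ℕ} (k : ℤ) (t : ℤ × Fin (N + 1)) :
    (tileShift N ^ k) t = (t.1 + k * N, t.2) := by
  have h1 : ∀ t : ℤ × Fin (N + 1), tileShift N t = (t.1 + N, t.2) := fun _ ↦ rfl
  induction k using Int.induction_on with
  | zero => simp
  | succ i ih =>
    rw [add_comm (i : ℤ), zpow_add, Equiv.Perm.mul_apply, ih, zpow_one, h1]
    ext <;> simp
    ring
  | pred i ih =>
    rw [sub_eq_neg_add, zpow_add, Equiv.Perm.mul_apply, ih, zpow_neg_one, Equiv.Perm.inv_eq_iff_eq,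
      h1]
    ext <;> simp
    ring

theorem isOpen_tile {N : ℕ} (t : ℤ × Fin (N + 1)) : IsOpen (tile N t) := by
  have h1 : Continuous fun z : ℂ ↦ N * z.re := by fun_prop
  have h2 : Continuous fun z : ℂ ↦ N * (z.im + 1) := by fun_prop
  exact ((isOpen_lt continuous_const h1).inter (isOpen_lt h1 continuous_const)).inter
    ((isOpen_lt continuous_const h2).inter (isOpen_lt h2 continuous_const))

theorem isPreconnected_tile {N : ℕ} (t : ℤ × Fin (N + 1)) : IsPreconnected (tile N t) := by
  refine Convex.isPreconnected ?_
  have h1 : IsLinearMap ℝ fun z : ℂ ↦ N * z.re := ⟨fun x y ↦ by simp; ring, fun c x ↦ by simp; ring⟩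
  have h2 : IsLinearMap ℝ fun z : ℂ ↦ N * z.im := ⟨fun x y ↦ by simp; ring, fun c x ↦ by simp; ring⟩
  have e : tile N t = ({z | (t.1 : ℝ) < N * z.re} ∩ {z | N * z.re < (t.1 + 1 : ℝ)}) ∩
      ({z | 2 * ((t.2 : ℕ) : ℝ) - 1 - N < N * z.im} ∩
        {z | N * z.im < 2 * ((t.2 : ℕ) : ℝ) + 1 - N}) := by
    ext z
    simp only [tile, mem_inter_iff, mem_ofPred_eq]
    refine and_congr Iff.rfl (and_congr ?_ ?_) <;> constructor <;> intro h <;> linarith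
  rw [e]
  exact ((convex_halfSpace_gt h1 (t.1 : ℝ)).inter (convex_halfSpace_lt h1 (t.1 + 1 : ℝ))).inter
    ((convex_halfSpace_gt h2 (2 * ((t.2 : ℕ) : ℝ) - 1 - N)).inter
      (convex_halfSpace_lt h2 (2 * ((t.2 : ℕ) : ℝ) + 1 - N)))

theorem eq_of_mem_tile {N : ℕ} {s t : ℤ × Fin (N + 1)} {z : ℂ} (hs : z ∈ tile N s)
    (ht : z ∈ tile N t) : s = t := by
  obtain ⟨⟨h1, h2⟩, h3, h4⟩ := hs
  obtain ⟨⟨k1, k2⟩, k3, k4⟩ := ht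
  have a1 : (s.1 : ℝ) < t.1 + 1 := h1.trans k2
  have a2 : (t.1 : ℝ) < s.1 + 1 := k1.trans h2
  have a3 : ((s.2 : ℕ) : ℝ) < (t.2 : ℕ) + 1 := by linarith
  have a4 : ((t.2 : ℕ) : ℝ) < (s.2 : ℕ) + 1 := by linarith
  norm_cast at a1 a2 a3 a4
  exact Prod.ext (by omega) (Fin.ext (by omega))

theorem norm_sub_lt_of_mem_tile {N : ℕ} (hN : 0 < N) {t : ℤ × Fin (N + 1)} {z w : ℂ}
    (hz : z ∈ tile N t) (hw : w ∈ tile N t) : ‖z - w‖ < 3 / N := by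
  obtain ⟨⟨h1, h2⟩, h3, h4⟩ := hz
  obtain ⟨⟨k1, k2⟩, k3, k4⟩ := hw
  have hN' : (0 : ℝ) < N := by exact_mod_cast hN
  rw [lt_div_iff₀ hN']
  have hre : |(z - w).re| * N < 1 := by
    rw [← abs_of_pos hN', ← abs_mul, abs_lt, Complex.sub_re]
    constructor <;> linarith
  have him : |(z - w).im| * N < 2 := by
    rw [← abs_of_pos hN', ← abs_mul, abs_lt, Complex.sub_im]
    constructor <;> linarith
  nlinarith [Complex.norm_le_abs_re_add_abs_im (z - w)]

theorem add_intCast_mem_tile_iff {N : ℕ} {t : ℤ × Fin (N + 1)} {z : ℂ} (k : ℤ) :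
    z + k ∈ tile N ((tileShift N ^ k) t) ↔ z ∈ tile N t := by
  rw [tileShift_zpow_apply]
  simp only [tile, mem_ofPred_eq, Complex.add_re, Complex.intCast_re, Complex.add_im,
    Complex.intCast_im, add_zero]
  push_cast
  refine and_congr (and_congr ?_ ?_) Iff.rfl <;> constructor <;> intro h <;> linarith

theorem stripEmb_deck_zpow (k : ℤ) (z : AnnulusCover) :
    stripEmb ((deck ^ k) z) = stripEmb z + k := by
  rw [deck_zpow_apply]
  apply Complex.ext <;> simp [stripEmb]

/-- The points of the strip which are in some tile. -/
def tiled (N : ℕ) : Set AnnulusCover := {z | ∃ t, stripEmb z ∈ tile N t}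

theorem isOpen_tiled (N : ℕ) : IsOpen (tiled N) := by
  rw [tiled, ofPred_exists]
  exact isOpen_iUnion fun t ↦ (isOpen_tile t).preimage continuous_stripEmb

theorem dense_tiled {N : ℕ} (hN : 0 < N) : Dense (tiled N) := by
  have hN' : (0 : ℝ) < N := by exact_mod_cast hN
  have hx : Dense {x : ℝ | ∃ i : ℤ, (i : ℝ) < N * x ∧ N * x < i + 1} := by
    have hc : Dense (range fun i : ℤ ↦ (i : ℝ) / N)ᶜ :=
      Set.Countable.dense_compl ℝ (countable_range _)
    refine hc.mono ?_
    intro x hx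
    refine ⟨⌊N * x⌋, lt_of_le_of_ne (Int.floor_le _) fun he ↦ hx ⟨⌊N * x⌋, ?_⟩,
      Int.lt_floor_add_one _⟩
    simp only
    rw [he, mul_div_cancel_left₀ _ hN'.ne']
  have hy : Dense {y : Icc (-1 : ℝ) 1 | ∃ j : Fin (N + 1),
      2 * ((j : ℕ) : ℝ) - 1 < N * ((y : ℝ) + 1) ∧ N * ((y : ℝ) + 1) < 2 * ((j : ℕ) : ℝ) + 1} := by
    have hfin : {y : Icc (-1 : ℝ) 1 | ∃ j : Fin (N + 1),
        2 * ((j : ℕ) : ℝ) - 1 = N * ((y : ℝ) + 1)}.Finite := by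
      refine ((finite_range fun j : Fin (N + 1) ↦ (2 * ((j : ℕ) : ℝ) - 1) / N - 1).preimage
        Subtype.val_injective.injOn).subset ?_
      rintro y ⟨j, hj⟩
      refine ⟨j, ?_⟩
      simp only
      rw [hj, mul_div_cancel_left₀ _ hN'.ne', add_sub_cancel_right]
    have : ConnectedSpace (Icc (-1 : ℝ) 1) := Subtype.connectedSpace (isConnected_Icc (by norm_num))
    have : Nontrivial (Icc (-1 : ℝ) 1) :=
      ⟨⟨⟨0, by norm_num⟩, ⟨1, by norm_num⟩, fun h ↦ zero_ne_one (congrArg Subtype.val h)⟩⟩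
    refine ((dense_univ (X := Icc (-1 : ℝ) 1)).sdiff_finite hfin).mono ?_
    rintro y ⟨-, hy⟩
    have h0 : 0 ≤ (N * ((y : ℝ) + 1) + 1) / 2 := by
      have := mul_nonneg hN'.le (neg_le_iff_add_nonneg.1 y.2.1)
      positivity
    have h1 := Nat.floor_le h0
    have h2 := Nat.lt_floor_add_one ((N * ((y : ℝ) + 1) + 1) / 2)
    have h3 : ⌊(N * ((y : ℝ) + 1) + 1) / 2⌋₊ < N + 1 := by
      rw [Nat.floor_lt h0]
      push_cast
      nlinarith [y.2.2]
    refine ⟨⟨_, h3⟩, lt_of_le_of_ne ?_ fun he ↦ hy ⟨⟨_, h3⟩, he⟩, ?_⟩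
    · simp only
      linarith
    · simp only
      linarith
  refine (hx.prod hy).mono ?_
  rintro ⟨x, y⟩ ⟨⟨i, hi⟩, j, hj⟩
  exact ⟨(i, j), hi, hj⟩

theorem exists_stripEmb_mem_tile {N : ℕ} (hN : 0 < N) (t : ℤ × Fin (N + 1)) :
    ∃ z, stripEmb z ∈ tile N t := by
  have hN' : (0 : ℝ) < N := by exact_mod_cast hN
  obtain ⟨i, j⟩ := t
  obtain ⟨v, hv0, hv1, hv2, hv3⟩ : ∃ v : ℝ, 0 ≤ v ∧ v ≤ 2 * N ∧ 2 * ((j : ℕ) : ℝ) - 1 < v ∧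
      v < 2 * ((j : ℕ) : ℝ) + 1 := by
    have : ((j : ℕ) : ℝ) ≤ N := by exact_mod_cast Nat.lt_succ_iff.1 j.2
    exact ⟨2 * (j : ℕ), by positivity, by linarith, by linarith, by linarith⟩
  refine ⟨((i + 1 / 2) / N, ⟨v / N - 1, ?_, ?_⟩), ⟨?_, ?_⟩, ?_, ?_⟩
  · have : 0 ≤ v / N := by positivity
    linarith
  · have : v / N ≤ 2 := by rwa [div_le_iff₀ hN']
    linarith
  all_goals
    simp only [stripEmb, sub_add_cancel, mul_div_cancel₀ _ hN'.ne']
  all_goals linarith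

/-- The transition relation of a map of the plane between tiles. -/
def TileEdge (N : ℕ) (H : ℂ → ℂ) (s t : ℤ × Fin (N + 1)) : Prop := ∃ z ∈ tile N s, H z ∈ tile N t

theorem tileEdge_shift {N : ℕ} {H : ℂ → ℂ} (hH : ∀ z, H (z + 1) = H z + 1)
    (s t : ℤ × Fin (N + 1)) :
    TileEdge N H s t ↔ TileEdge N H (tileShift N s) (tileShift N t) := by
  have key : ∀ (z : ℂ) (u : ℤ × Fin (N + 1)), z + 1 ∈ tile N (tileShift N u) ↔ z ∈ tile N u := by
    intro z u
    simpa using add_intCast_mem_tile_iff (t := u) (z := z) 1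
  constructor
  · rintro ⟨z, hz, hz'⟩
    exact ⟨z + 1, (key _ _).2 hz, by rw [hH]; exact (key _ _).2 hz'⟩
  · rintro ⟨z, hz, hz'⟩
    have e := hH (z - 1)
    rw [sub_add_cancel] at e
    refine ⟨z - 1, (key _ _).1 (by rwa [sub_add_cancel]), (key _ _).1 ?_⟩
    rwa [← e]

theorem reflTransGen_row {N : ℕ} (hN : 0 < N) {H : ℂ → ℂ} (hH : ∀ z, H (z + 1) = H z + 1)
    {j : Fin (N + 1)} {y : ℝ} {e : ℤ} (hy : 2 * ((j : ℕ) : ℝ) - 1 < N * (y + 1))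
    (hy' : N * (y + 1) < 2 * ((j : ℕ) : ℝ) + 1)
    (hrow : ∀ z : ℂ, z.im = y → H z = z + e + ((1 / (2 * N) : ℝ) : ℂ)) (i i' : ℤ) :
    ∃ k : ℤ, Relation.ReflTransGen (TileEdge N H) (i, j) ((tileShift N ^ k) (i', j)) := by
  have hN' : (0 : ℝ) < N := by exact_mod_cast hN
  have hE := tileEdge_shift (N := N) hH
  have hstep : ∀ i : ℤ, TileEdge N H (i, j) ((tileShift N ^ e) (i + 1, j)) := by
    intro i
    have e1 : (N : ℝ) * ((i + 3 / 4) / N) = i + 3 / 4 := mul_div_cancel₀ _ hN'.ne'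
    have e2 : (N : ℝ) * (1 / (2 * N)) = 1 / 2 := by field_simp
    refine ⟨⟨(i + 3 / 4) / N, y⟩, ⟨⟨?_, ?_⟩, hy, hy'⟩, ?_⟩
    · simp only [e1]; linarith
    · simp only [e1]; linarith
    · rw [hrow _ rfl, tileShift_zpow_apply]
      simp only [tile, mem_ofPred_eq, Complex.add_re, Complex.intCast_re, Complex.add_im,
        Complex.intCast_im, add_zero, Complex.ofReal_re, Complex.ofReal_im, mul_add, e1, e2]
      push_cast
      refine ⟨⟨by linarith, by linarith⟩, by linarith, by linarith⟩
  have hup : ∀ n : ℕ, ∃ k : ℤ,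
      Relation.ReflTransGen (TileEdge N H) (i, j) ((tileShift N ^ k) (i + n, j)) := by
    intro n
    induction n with
    | zero => exact ⟨0, by simpa using Relation.ReflTransGen.refl⟩
    | succ n ih =>
      obtain ⟨k, hk⟩ := ih
      refine ⟨k + e, ?_⟩
      have := reflTransGen_zpow_trans hE hk (Relation.ReflTransGen.single (hstep (i + n)))
      rwa [show i + (n : ℤ) + 1 = i + ((n + 1 : ℕ) : ℤ) by push_cast; ring] at this
  obtain ⟨k, hk⟩ := hup (i' + |i - i'| * N - i).toNat
  refine ⟨k + |i - i'|, ?_⟩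
  have h1 : i - i' ≤ |i - i'| * N := by
    have : (1 : ℤ) ≤ N := by exact_mod_cast hN
    nlinarith [le_abs_self (i - i'), abs_nonneg (i - i')]
  rw [Int.toNat_of_nonneg (by linarith)] at hk
  rw [zpow_add, Equiv.Perm.mul_apply, tileShift_zpow_apply |i - i'|]
  simpa using hk

instance instPreconnectedSpaceAnnulus : PreconnectedSpace Annulus := by
  have : ConnectedSpace (Icc (-1 : ℝ) 1) := Subtype.connectedSpace (isConnected_Icc (by norm_num))
  have : PreconnectedSpace AnnulusCover := inferInstance
  have : IsPreconnected (univ : Set Annulus) := by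
    rw [← annulusProj_surjective.range_eq]
    exact isPreconnected_range continuous_annulusProj
  exact ⟨this⟩

/-- For an area preserving homeomorphism without compact invariant sets in the interior, a closed
forward invariant set which is the closure of an open set and whose frontier does not meet the
boundary is trivial. -/
theorem IsGoodPair.closure_eq_univ {g : Annulus ≃ₜ Annulus} {gt : AnnulusCover ≃ₜ AnnulusCover}
    (h : IsGoodPair g gt) {U : Set Annulus} (hU : IsOpen U) (hne : U.Nonempty)
    (hinv : g '' U ⊆ closure U) (hfr : frontier (closure U) ⊆ annulusInt) :
    closure U = univ := by
  have h1 : g '' closure U ⊆ closure U := by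
    rw [g.image_closure]
    exact closure_minimal hinv isClosed_closure
  have hcl : IsClosed (g '' closure U) := g.isClosedMap _ isClosed_closure
  have h2 : g '' closure U = closure U := by
    refine h1.antisymm (closure_minimal ?_ hcl)
    have hvol : volume (g '' closure U) = volume (closure U) := by
      have := h.area.measure_preimage hcl.measurableSet.nullMeasurableSet
      rw [preimage_image_eq _ g.injective] at this
      exact this.symm
    have hz : volume (closure U \ g '' closure U) = 0 := by
      rw [measure_sdiff h1 hcl.measurableSet.nullMeasurableSet (measure_ne_top _ _), hvol,
        tsub_self]
    have ho : IsOpen (U \ g '' closure U) := hU.sdiff hcl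
    have he := ho.eq_empty_of_measure_zero
      (measure_mono_null (sdiff_subset_sdiff_left subset_closure) hz)
    exact sdiff_eq_empty.1 he
  have h3 : frontier (closure U) = ∅ := by
    by_contra hne'
    refine h.nicis ⟨_, nonempty_iff_ne_empty.2 hne', isClosed_frontier.isCompact, ?_, hfr⟩
    rw [g.image_frontier, h2]
  rcases isClopen_iff.1 (isClopen_iff_frontier_eq_empty.2 h3) with h4 | h4
  · exact absurd ((closure_empty_iff _).1 h4) hne.ne_empty
  · exact h4

/-- Every tile can be reached from any other one, up to deck transformations. -/
theorem IsGoodPair.reflTransGen_tiles {g : Annulus ≃ₜ Annulus} {gt : AnnulusCover ≃ₜ AnnulusCover}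
    (h : IsGoodPair g gt) {N : ℕ} (hN : 0 < N) {H : ℂ → ℂ}
    (hHs : ∀ z, H (stripEmb z) = stripEmb (gt z)) (hH : ∀ z, H (z + 1) = H z + 1) {e₁ e₂ : ℤ}
    (htop : ∀ z : ℂ, 1 + 1 / (2 * N) ≤ z.im → H z = z + e₁ + ((1 / (2 * N) : ℝ) : ℂ))
    (hbot : ∀ z : ℂ, z.im ≤ -1 - 1 / (2 * N) → H z = z + e₂ + ((1 / (2 * N) : ℝ) : ℂ))
    (a b : ℤ × Fin (N + 1)) :
    ∃ k : ℤ, Relation.ReflTransGen (TileEdge N H) a ((tileShift N ^ k) b) := by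
  have hN' : (0 : ℝ) < N := by exact_mod_cast hN
  have hE := tileEdge_shift (N := N) hH
  let R : Set (ℤ × Fin (N + 1)) :=
    {t | ∃ k : ℤ, Relation.ReflTransGen (TileEdge N H) a ((tileShift N ^ k) t)}
  have hRtrans : ∀ {s t} {k : ℤ}, s ∈ R →
      Relation.ReflTransGen (TileEdge N H) s ((tileShift N ^ k) t) → t ∈ R := by
    rintro s t k ⟨l, hl⟩ hst
    exact ⟨l + k, reflTransGen_zpow_trans hE hl hst⟩
  have hRshift : ∀ {t} (k : ℤ), t ∈ R → (tileShift N ^ k) t ∈ R := by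
    intro t k ht
    refine hRtrans (k := -k) ht ?_
    rw [← Equiv.Perm.mul_apply, ← zpow_add, neg_add_cancel, zpow_zero]
    exact Relation.ReflTransGen.refl
  have haR : a ∈ R := ⟨0, by simpa using Relation.ReflTransGen.refl⟩
  let W : Set AnnulusCover := {z | ∃ t ∈ R, stripEmb z ∈ tile N t}
  have hW : IsOpen W := by
    have : W = ⋃ t ∈ R, stripEmb ⁻¹' tile N t := by
      ext z; simp [W]
    rw [this]
    exact isOpen_biUnion fun t _ ↦ (isOpen_tile t).preimage continuous_stripEmb
  have hU : IsOpen (annulusProj '' W) := isOpenMap_annulusProj W hW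
  have hUne : (annulusProj '' W).Nonempty := by
    obtain ⟨z, hz⟩ := exists_stripEmb_mem_tile hN a
    exact ⟨_, z, ⟨a, haR, hz⟩, rfl⟩
  have hinv : g '' (annulusProj '' W) ⊆ closure (annulusProj '' W) := by
    rintro _ ⟨_, ⟨z, ⟨t, ht, hz⟩, rfl⟩, rfl⟩
    rw [h.proj, mem_closure_iff]
    intro O hO hzO
    have hO' : IsOpen ((annulusProj ∘ gt) ⁻¹' O ∩ stripEmb ⁻¹' tile N t) :=
      (hO.preimage (continuous_annulusProj.comp gt.continuous)).inter
        ((isOpen_tile t).preimage continuous_stripEmb)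
    obtain ⟨z', ⟨hz1, hz2⟩, t', hz3⟩ :=
      ((dense_tiled hN).preimage gt.isOpenMap).inter_open_nonempty _ hO' ⟨z, hzO, hz⟩
    refine ⟨_, hz1, gt z', ⟨t', hRtrans (k := 0) ht (Relation.ReflTransGen.single ?_), hz3⟩, rfl⟩
    exact ⟨stripEmb z', hz2, by rw [hHs]; exact hz3⟩
  have hrow : ∀ j : Fin (N + 1), (∀ i i', ∃ k : ℤ,
      Relation.ReflTransGen (TileEdge N H) (i, j) ((tileShift N ^ k) (i', j))) →
      ∀ w : Annulus, 2 * ((j : ℕ) : ℝ) - 1 < N * ((w.2 : ℝ) + 1) →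
      N * ((w.2 : ℝ) + 1) < 2 * ((j : ℕ) : ℝ) + 1 →
      w ∉ frontier (closure (annulusProj '' W)) := by
    intro j hj w hw1 hw2 hw
    have hj2 : ∀ z : AnnulusCover, ∀ t, stripEmb z ∈ tile N t →
        2 * ((j : ℕ) : ℝ) - 1 < N * ((z.2 : ℝ) + 1) →
        N * ((z.2 : ℝ) + 1) < 2 * ((j : ℕ) : ℝ) + 1 → t.2 = j := by
      rintro z ⟨i, j'⟩ ⟨h1, h2⟩ h3 h4
      exact congrArg Prod.snd (eq_of_mem_tile (s := (i, j')) (t := (i, j)) ⟨h1, h2⟩ ⟨h1, h3, h4⟩)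
    let O : Set Annulus := {w | 2 * ((j : ℕ) : ℝ) - 1 < N * ((w.2 : ℝ) + 1) ∧
      N * ((w.2 : ℝ) + 1) < 2 * ((j : ℕ) : ℝ) + 1}
    have hO : IsOpen O := by
      have hc : Continuous fun w : Annulus ↦ N * ((w.2 : ℝ) + 1) := by fun_prop
      exact (isOpen_lt continuous_const hc).inter (isOpen_lt hc continuous_const)
    by_cases h0 : (0, j) ∈ R
    · have hall : ∀ i, (i, j) ∈ R := fun i ↦ by
        obtain ⟨k, hk⟩ := hj 0 i
        exact hRtrans h0 hk
      have hsub : O ⊆ closure (annulusProj '' W) := by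
        intro w hw
        obtain ⟨z, rfl⟩ := annulusProj_surjective w
        rw [mem_closure_iff]
        intro O' hO' hzO'
        obtain ⟨z', ⟨hz1, hz2⟩, t, hz3⟩ := (dense_tiled hN).inter_open_nonempty _
          ((hO'.inter hO).preimage continuous_annulusProj) ⟨z, hzO', hw⟩
        obtain rfl := hj2 z' t hz3 hz2.1 hz2.2
        exact ⟨_, hz1, z', ⟨t, hall t.1, hz3⟩, rfl⟩
      exact hw.2 (interior_maximal hsub hO ⟨hw1, hw2⟩)
    · have hdis : Disjoint O (closure (annulusProj '' W)) := by
        refine Disjoint.closure_right (disjoint_left.2 ?_) hO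
        rintro _ ⟨h1, h2⟩ ⟨z, ⟨t, ht, hz⟩, rfl⟩
        obtain rfl := hj2 z t hz h1 h2
        obtain ⟨k, hk⟩ := hj t.1 0
        exact h0 (hRtrans ht hk)
      refine disjoint_left.1 hdis ⟨hw1, hw2⟩ ?_
      simpa using frontier_subset_closure hw
  have hfr : frontier (closure (annulusProj '' W)) ⊆ annulusInt := by
    intro w hw
    have e2 : (N : ℝ) * (3 / (4 * N)) = 3 / 4 := by field_simp
    have e3 : 1 / (2 * N : ℝ) ≤ 3 / (4 * N) := by
      rw [div_le_div_iff₀ (by positivity) (by positivity)]; linarith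
    constructor
    · refine lt_of_le_of_ne w.2.2.1 fun he ↦ hrow 0 (fun i i' ↦ ?_) w ?_ ?_ hw
      · refine reflTransGen_row hN hH (y := -1 - 3 / (4 * N)) (e := e₂) ?_ ?_
          (fun z hz ↦ hbot z (by linarith)) i i'
        all_goals
          simp only [Fin.val_zero, Nat.cast_zero]
          linarith
      all_goals
        rw [← he]
        norm_num
    · refine lt_of_le_of_ne w.2.2.2 fun he ↦ hrow (Fin.last N) (fun i i' ↦ ?_) w ?_ ?_ hw
      · refine reflTransGen_row hN hH (y := 1 + 3 / (4 * N)) (e := e₁) ?_ ?_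
          (fun z hz ↦ htop z (by linarith)) i i'
        all_goals
          simp only [Fin.val_last]
          linarith
      all_goals
        rw [he, Fin.val_last]
        linarith
  have huniv := h.closure_eq_univ hU hUne hinv hfr
  obtain ⟨z, hz⟩ := exists_stripEmb_mem_tile hN b
  have hmem : annulusProj z ∈ closure (annulusProj '' W) := huniv ▸ mem_univ _
  obtain ⟨_, ⟨z₁, hz₁, he⟩, z₂, ⟨t, ht, hz₂⟩, rfl⟩ := mem_closure_iff.1 hmem _
    (isOpenMap_annulusProj _ ((isOpen_tile b).preimage continuous_stripEmb)) ⟨z, hz, rfl⟩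
  obtain ⟨k, rfl⟩ := annulusProj_eq_iff.1 he
  rw [mem_preimage, stripEmb_deck_zpow] at hz₁
  rw [eq_of_mem_tile hz₁ ((add_intCast_mem_tile_iff k).2 hz₂)]
  exact hRshift k ht

theorem exists_tileShift_zpow_eq {N : ℕ} (hN : 0 < N) (t : ℤ × Fin (N + 1)) :
    ∃ (k : ℤ) (x : ℤ × Fin (N + 1)), x.1 ∈ Ico (0 : ℤ) N ∧ t = (tileShift N ^ k) x ∧
      ∀ z ∈ tile N t, (k : ℝ) < z.re ∧ z.re < k + 1 := by
  have hN' : (0 : ℤ) < N := by exact_mod_cast hN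
  have hN'' : (0 : ℝ) < N := by exact_mod_cast hN
  have h1 := Int.emod_nonneg t.1 hN'.ne'
  have h2 := Int.emod_lt_of_pos t.1 hN'
  have h3 := Int.emod_add_ediv_mul t.1 N
  refine ⟨t.1 / N, (t.1 % N, t.2), ⟨h1, h2⟩, ?_, ?_⟩
  · rw [tileShift_zpow_apply]
    simp only [h3]
  · rintro z ⟨⟨h4, h5⟩, -⟩
    have h6 : ((t.1 / N : ℤ) : ℝ) * N ≤ t.1 := by exact_mod_cast (by linarith)
    have h7 : (t.1 : ℝ) + 1 ≤ ((t.1 / N : ℤ) : ℝ) * N + N := by exact_mod_cast (by linarith)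
    constructor <;> nlinarith

/-- Orbits can be followed, up to a perturbation, by walks between tiles. -/
theorem exists_walk_of_orbit {gt : AnnulusCover ≃ₜ AnnulusCover} {N : ℕ} (hN : 0 < N) {H : ℂ → ℂ}
    (hHs : ∀ z, H (stripEmb z) = stripEmb (gt z)) (hH : ∀ z, H (z + 1) = H z + 1)
    {n : ℕ} {I : Set ℝ} (hI : IsOpen I) (hz : ∃ z, ((gt ^ n) z).1 - z.1 ∈ I) :
    ∃ x y : ℤ × Fin (N + 1), x.1 ∈ Ico (0 : ℤ) N ∧ y.1 ∈ Ico (0 : ℤ) N ∧ ∃ k : ℤ,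
      Relation.ReflTransGen (TileEdge N H) x ((tileShift N ^ k) y) ∧ ∃ r ∈ I, |k - r| < 1 := by
  have hG : Dense (⋂ i : ℕ, (gt ^ i : AnnulusCover ≃ₜ AnnulusCover) ⁻¹' tiled N) :=
    dense_iInter_of_isOpen (fun i ↦ (isOpen_tiled N).preimage (gt ^ i).continuous)
      fun i ↦ (dense_tiled hN).preimage (gt ^ i).isOpenMap
  obtain ⟨z, hzI, hzG⟩ := hG.inter_open_nonempty _ (hI.preimage
    (show Continuous fun z ↦ ((gt ^ n) z).1 - z.1 from
      (continuous_fst.comp (gt ^ n).continuous).sub continuous_fst)) hz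
  choose t ht using mem_iInter.1 hzG
  have hwalk : ∀ m, Relation.ReflTransGen (TileEdge N H) (t 0) (t m) := by
    intro m
    induction m with
    | zero => exact Relation.ReflTransGen.refl
    | succ m ih =>
      refine ih.tail ⟨_, ht m, ?_⟩
      have := ht (m + 1)
      rwa [pow_succ', Homeomorph.mul_apply, ← hHs] at this
  obtain ⟨k, x, hx, hkx, hk⟩ := exists_tileShift_zpow_eq hN (t 0)
  obtain ⟨l, y, hy, hly, hl⟩ := exists_tileShift_zpow_eq hN (t n)
  refine ⟨x, y, hx, hy, -k + l, ?_, _, hzI, ?_⟩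
  · have := reflTransGen_zpow (tileEdge_shift hH) (hwalk n) (-k)
    rwa [hkx, hly, ← Equiv.Perm.mul_apply, ← zpow_add, neg_add_cancel, zpow_zero,
      Equiv.Perm.one_apply, ← Equiv.Perm.mul_apply, ← zpow_add] at this
  · have h1 := hk _ (ht 0)
    have h2 := hl _ (ht n)
    simp only [stripEmb, pow_zero, Homeomorph.one_apply] at h1 h2
    push_cast
    rw [abs_lt]
    constructor <;> linarith [h1.1, h1.2, h2.1, h2.2]

/-- A lift without fixed points on the boundary cannot have orbits drifting in both directions. -/
theorem IsGoodPair.false_of_drift {g : Annulus ≃ₜ Annulus} {gt : AnnulusCover ≃ₜ AnnulusCover}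
    (h : IsGoodPair g gt) (hb : ∀ z, |(z.2 : ℝ)| = 1 → gt z ≠ z)
    (hneg : ∀ K : ℝ, ∃ n z, ((gt ^ n) z).1 - z.1 < K)
    (hpos : ∀ K : ℝ, ∃ n z, K < ((gt ^ n) z).1 - z.1) : False := by
  have hfix : ∀ z, gt z ≠ z := fun z ↦ by
    rcases (abs_le.2 z.2.2).lt_or_eq with hz | hz
    · exact h.ne_of_interior hz
    · exact hb z hz
  obtain ⟨δ, hδ, hext⟩ := h.strip.exists_extension hfix
  obtain ⟨N, hNδ⟩ := exists_nat_gt (3 / δ)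
  have hN' : (0 : ℝ) < N := lt_trans (by positivity) hNδ
  have hN : 0 < N := by exact_mod_cast hN'
  obtain ⟨H, hl, hHs, hH, hdisp, e₁, e₂, htop, hbot⟩ := hext N hN
  have hfree : ∀ t : ℤ × Fin (N + 1), ∀ z ∈ tile N t, H z ∉ tile N t := by
    intro t z hz hHz
    have h1 := norm_sub_lt_of_mem_tile hN hHz hz
    have h2 := hdisp z
    rw [div_lt_iff₀ hδ] at hNδ
    rw [lt_div_iff₀ hN'] at h1
    nlinarith
  obtain ⟨a, ha⟩ := exists_transGen_self_of_drift (E := TileEdge N H) (σ := tileShift N)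
    (X := Ico (0 : ℤ) N ×ˢ univ) (tileEdge_shift hH) (fun a k hk ↦ by
      have := congrArg Prod.fst ((tileShift_zpow_apply k a).symm.trans hk)
      have h0 : k * (N : ℤ) = 0 := by simpa using this
      exact (mul_eq_zero.1 h0).resolve_right (by exact_mod_cast hN.ne'))
    ((finite_Ico _ _).prod finite_univ) (h.reflTransGen_tiles hN hHs hH htop hbot)
    (fun K ↦ by
      obtain ⟨n, hz⟩ := hneg (K - 1)
      obtain ⟨x, y, hx, hy, k, hk, r, hr, hkr⟩ := exists_walk_of_orbit hN hHs hH isOpen_Iio hz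
      refine ⟨x, ⟨hx, mem_univ _⟩, y, ⟨hy, mem_univ _⟩, k, ?_, hk⟩
      have hr : r < K - 1 := hr
      have : (k : ℝ) < K := by linarith [(abs_lt.1 hkr).2]
      exact_mod_cast this)
    (fun K ↦ by
      obtain ⟨n, hz⟩ := hpos (K + 1)
      obtain ⟨x, y, hx, hy, k, hk, r, hr, hkr⟩ := exists_walk_of_orbit hN hHs hH isOpen_Ioi hz
      refine ⟨x, ⟨hx, mem_univ _⟩, y, ⟨hy, mem_univ _⟩, k, ?_, hk⟩
      have hr : K + 1 < r := hr
      have : (K : ℝ) < k := by linarith [(abs_lt.1 hkr).1]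
      exact_mod_cast this)
  obtain ⟨n, hn, d, hd, hchain⟩ := exists_cycle_of_transGen ha
  refine false_of_periodic_diskChain H hl (fun z hz ↦ ?_) hn (fun i ↦ tile N (d i))
    (fun i _ ↦ isOpen_tile _) (fun i _ ↦ isPreconnected_tile _) (fun i _ ↦ hfree _)
    (fun i hi j hj hij ↦ disjoint_left.2 fun z hz hz' ↦ hd i hi j hj hij (eq_of_mem_tile hz hz'))
    hchain
  have := hdisp z
  rw [hz, sub_self, norm_zero] at this
  linarith

/-- On an invariant line of the strip, at most one rational rotation number has periodic
points. -/
theorem exists_translationNumber {G : AnnulusCover ≃ₜ AnnulusCover}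
    (hs : ∀ z : AnnulusCover, G (z.1 + 1, z.2) = ((G z).1 + 1, (G z).2)) (y : Icc (-1 : ℝ) 1)
    (hy : ∀ x : ℝ, (G (x, y)).2 = y) (hm : StrictMono fun x : ℝ ↦ (G (x, y)).1) :
    ∃ ρ : ℝ, ∀ (q : ℕ) (p : ℤ) (x : ℝ), q ≠ 0 → (deck ^ (-p) * G ^ q) (x, y) = (x, y) →
      ρ = p / q := by
  let c : CircleDeg1Lift := ⟨⟨fun x ↦ (G (x, y)).1, hm.monotone⟩, fun x ↦
    congrArg Prod.fst (hs (x, y))⟩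
  have hc : ∀ (n : ℕ) (x : ℝ), (G ^ n) (x, y) = ((c ^ n) x, y) := by
    intro n x
    induction n with
    | zero => rfl
    | succ n ih =>
      rw [pow_succ', Homeomorph.mul_apply, ih, pow_succ', CircleDeg1Lift.mul_apply]
      exact Prod.ext rfl (hy _)
  refine ⟨CircleDeg1Lift.translationNumber c, fun q p x hq he ↦ ?_⟩
  refine CircleDeg1Lift.translationNumber_of_map_pow_eq_add_int c (x := x) ?_
    (Nat.pos_of_ne_zero hq)
  rw [Homeomorph.mul_apply, hc, deck_zpow_apply] at he
  have := congrArg Prod.fst he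
  push_cast at this
  linarith

theorem integral_birkhoffSum {f : Annulus ≃ₜ Annulus} {F : Annulus → ℝ} (hF : Continuous F)
    {μ : Measure Annulus} [IsProbabilityMeasure μ] (hμ : MeasurePreserving f μ μ) (n : ℕ) :
    Integrable (birkhoffSum f F n) μ ∧ ∫ z, birkhoffSum f F n z ∂μ = n * ∫ z, F z ∂μ := by
  have hi : Integrable F μ := hF.integrable_of_hasCompactSupport (HasCompactSupport.of_compactSpace F)
  have hfn : ∀ n : ℕ, MeasurePreserving f^[n] μ μ := fun n ↦ hμ.iterate n
  have hin : ∀ n : ℕ, Integrable (fun z ↦ F (f^[n] z)) μ := fun n ↦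
    (hfn n).integrable_comp_of_integrable hi
  refine ⟨integrable_finsetSum _ fun i _ ↦ hin i, ?_⟩
  simp only [birkhoffSum]
  rw [integral_finsetSum _ fun i _ ↦ hin i]
  have : ∀ i ∈ Finset.range n, ∫ z, F (f^[i] z) ∂μ = ∫ z, F z ∂μ := by
    intro i _
    have h1 := integral_map (μ := μ) (hfn i).measurable.aemeasurable
      (f := F) hF.aestronglyMeasurable
    rw [(hfn i).map_eq] at h1
    exact h1.symm
  rw [Finset.sum_congr rfl this, Finset.sum_const, Finset.card_range, nsmul_eq_mul]

theorem integral_le_of_invariant {f : Annulus ≃ₜ Annulus} {ft : AnnulusCover ≃ₜ AnnulusCover}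
    (harea : MeasurePreserving f volume volume) (hlift : IsLift f ft) (hnicis : NICIS f)
    {F : Annulus → ℝ} (hFcont : Continuous F)
    (hF : ∀ z : AnnulusCover, F (annulusProj z) = (ft z).1 - z.1) {μ ν : Measure Annulus}
    [IsProbabilityMeasure μ] [IsProbabilityMeasure ν] (hμ : MeasurePreserving f μ μ)
    (hν : MeasurePreserving f ν ν) : ∫ z, F z ∂ν ≤ ∫ z, F z ∂μ := by
  by_contra! hlt
  have hsq := isStripMap_sq hlift.1
  obtain ⟨ρ₁, hρ₁⟩ := exists_translationNumber hsq.shift ⟨1, by norm_num⟩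
    (fun x ↦ Subtype.ext ((hsq.top _).2 rfl)) hsq.strictMono_top
  obtain ⟨ρ₂, hρ₂⟩ := exists_translationNumber hsq.shift ⟨-1, by norm_num⟩
    (fun x ↦ Subtype.ext ((hsq.bot _).2 rfl)) hsq.strictMono_bot
  obtain ⟨r, ⟨⟨hr1, hr2⟩, hr3⟩⟩ : ∃ r : ℚ, (r : ℝ) ∈
      Ioo (2 * ∫ z, F z ∂μ) (2 * ∫ z, F z ∂ν) \ {ρ₁, ρ₂} := by
    have ho : IsOpen (Ioo (2 * ∫ z, F z ∂μ) (2 * ∫ z, F z ∂ν) \ {ρ₁, ρ₂}) :=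
      isOpen_Ioo.sdiff (toFinite _).isClosed
    obtain ⟨_, hx, r, rfl⟩ := Rat.denseRange_cast.inter_open_nonempty _ ho
      ((Ioo_infinite (by linarith)).sdiff (toFinite {ρ₁, ρ₂})).nonempty
    exact ⟨r, hx⟩
  have hq : r.den ≠ 0 := r.den_nz
  have hq' : (0 : ℝ) < r.den := by exact_mod_cast r.den_pos
  have hr : (r : ℝ) = r.num / r.den := by exact_mod_cast (Rat.num_div_den r).symm
  have hgood := isGoodPair_of_isLift harea hlift hnicis hq r.num
  have hdisp : ∀ (n : ℕ) (z : AnnulusCover),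
      (((deck ^ (-r.num) * ft ^ (2 * r.den)) ^ n) z).1 - z.1
        = birkhoffSum f F (2 * r.den * n) (annulusProj z) - r * r.den * n := by
    intro n z
    rw [fst_pow_deck_mul hlift.1, fst_pow_sub_eq_birkhoffSum hlift.2 hF, hr,
      div_mul_cancel₀ _ hq'.ne']
  refine hgood.false_of_drift ?_ ?_ ?_
  · rintro ⟨x, y⟩ hy he
    rw [pow_mul, sq] at he
    rcases eq_or_eq_neg_of_abs_eq hy with h1 | h1
    · obtain rfl : y = ⟨1, by norm_num⟩ := Subtype.ext h1
      exact hr3 (Or.inl (hr.trans (hρ₁ _ _ x hq he).symm))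
    · obtain rfl : y = ⟨-1, by norm_num⟩ := Subtype.ext h1
      exact hr3 (Or.inr (hr.trans (hρ₂ _ _ x hq he).symm))
  · intro K
    have hd : 0 < (r - 2 * ∫ z, F z ∂μ) * r.den := mul_pos (sub_pos.2 hr1) hq'
    obtain ⟨n, hn⟩ := exists_nat_gt (-K / ((r - 2 * ∫ z, F z ∂μ) * r.den))
    rw [div_lt_iff₀ hd] at hn
    obtain ⟨hi, he⟩ := integral_birkhoffSum hFcont hμ (2 * r.den * n)
    obtain ⟨w, hw⟩ := exists_le_integral hi
    obtain ⟨z, rfl⟩ := annulusProj_surjective w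
    refine ⟨n, z, ?_⟩
    rw [hdisp]
    rw [he] at hw
    push_cast at hw
    nlinarith
  · intro K
    have hd : 0 < (2 * ∫ z, F z ∂ν - r) * r.den := mul_pos (sub_pos.2 hr2) hq'
    obtain ⟨n, hn⟩ := exists_nat_gt (K / ((2 * ∫ z, F z ∂ν - r) * r.den))
    rw [div_lt_iff₀ hd] at hn
    obtain ⟨hi, he⟩ := integral_birkhoffSum hFcont hν (2 * r.den * n)
    obtain ⟨w, hw⟩ := exists_integral_le hi
    obtain ⟨z, rfl⟩ := annulusProj_surjective w
    refine ⟨n, z, ?_⟩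
    rw [hdisp]
    rw [he] at hw
    push_cast at hw
    nlinarith

theorem exists_invariant_probability {f : Annulus ≃ₜ Annulus}
    (harea : MeasurePreserving f volume volume) :
    ∃ μ : Measure Annulus, IsProbabilityMeasure μ ∧ MeasurePreserving f μ μ := by
  have : NeZero (volume : Measure Annulus) :=
    ⟨fun h0 ↦ (isOpen_univ.measure_pos (volume : Measure Annulus)
      ⟨annulusProj (0, ⟨0, by norm_num⟩), mem_univ _⟩).ne' (by simp [h0])⟩
  exact ⟨(volume (univ : Set Annulus))⁻¹ • volume, isProbabilityMeasureSMul,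
    harea.smul_measure _⟩

/-- The rotation set of a lift of a NICIS homeomorphism is a single irrational number. -/
theorem stmt_2 (f : Annulus ≃ₜ Annulus) (ft : AnnulusCover ≃ₜ AnnulusCover)
    (harea : MeasurePreserving f volume volume)
    (hlift : IsLift f ft) (hnicis : NICIS f)
    (F : Annulus → ℝ) (hFcont : Continuous F)
    (hF : ∀ z : AnnulusCover, F (annulusProj z) = (ft z).1 - z.1) :
    ∃ α : ℝ, Irrational α ∧
      ∀ μ : Measure Annulus, IsProbabilityMeasure μ → MeasurePreserving f μ μ →
        ∫ z, F z ∂μ = α := by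
  obtain ⟨ν, hν, hνf⟩ := exists_invariant_probability harea
  have huniq : ∀ μ : Measure Annulus, IsProbabilityMeasure μ → MeasurePreserving f μ μ →
      ∫ z, F z ∂μ = ∫ z, F z ∂ν := fun μ hμ hμf ↦
    le_antisymm (integral_le_of_invariant harea hlift hnicis hFcont hF hνf hμf)
      (integral_le_of_invariant harea hlift hnicis hFcont hF hμf hνf)
  refine ⟨∫ z, F z ∂ν, ?_, huniq⟩
  rintro ⟨r, hr⟩
  have hq : r.den ≠ 0 := r.den_nz
  have hq' : (0 : ℝ) < r.den := by exact_mod_cast r.den_pos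
  have hr' : (r : ℝ) = r.num / r.den := by exact_mod_cast (Rat.num_div_den r).symm
  refine (isGoodPair_of_isLift harea hlift hnicis hq (2 * r.num)).false_of_sublinear
    fun ε hε ↦ ?_
  obtain ⟨C, hC⟩ := exists_birkhoffSum_bound f.continuous hFcont huniq
    (ε := ε / (2 * r.den)) (by positivity)
  refine ⟨C, fun n z ↦ ?_⟩
  rw [fst_pow_deck_mul hlift.1, fst_pow_sub_eq_birkhoffSum hlift.2 hF]
  have h1 := hC (2 * r.den * n) (annulusProj z)
  rw [← hr, hr'] at h1
  push_cast at h1 ⊢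
  rw [show (2 * r.den * n : ℝ) * (r.num / r.den) = 2 * r.num * n by field_simp,
    show ε / (2 * r.den) * (2 * r.den * n : ℝ) = ε * n by field_simp] at h1
  exact h1
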